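/- arXiv:math/0609708 — 2 statements merged into one kernel-verified Lean document; each statement's English description precedes it below -/
import Mathlib

section
/- Let q > 1 be a real number. (i) If q belongs to the closure of U, then q is neither stable from below nor stable from above. (ii) If q belongs to V but not to the closure of U, then q is stable from below but not stable from above. (iii) If q does not belong to V, then q is stable from below and stable from above. -/
open Classical

noncomputable section

/-- The largest digit in base `q`: `α₁ = ⌈q⌉ - 1`. -/
def alphaOne (q : ℝ) : ℕ := (⌈q⌉ - 1).toNat

/-- `c` (0-indexed: `c i` is the digit `c_{i+1}` of the paper) is an expansion of `x`
in base `q`: all digits lie in `{0, …, α₁}` and `x = ∑_{i≥1} c_i q^{-i}`. -/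
def IsExpansionOf (q x : ℝ) (c : ℕ → ℕ) : Prop :=
  (∀ i, c i ≤ alphaOne q) ∧ x = ∑' i, (c i : ℝ) / q ^ (i + 1)

/-- A sequence is called infinite if it has infinitely many nonzero terms. -/
def InfiniteSeq (c : ℕ → ℕ) : Prop := {i | c i ≠ 0}.Infinite

/-- Strict lexicographic order on sequences. -/
def LexLt (a b : ℕ → ℕ) : Prop := ∃ n, (∀ i, i < n → a i = b i) ∧ a n < b n

/-- Lexicographic order `≤` on sequences. -/
def LexLe (a b : ℕ → ℕ) : Prop := LexLt a b ∨ a = b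

/-- `b` is the greedy (lexicographically largest) expansion of `x` in base `q`. -/
def IsGreedyOf (q x : ℝ) (b : ℕ → ℕ) : Prop :=
  IsExpansionOf q x b ∧ ∀ c, IsExpansionOf q x c → LexLe c b

/-- `a` is the quasi-greedy (lexicographically largest infinite) expansion of `x`
in base `q`. -/
def IsQuasiGreedyOf (q x : ℝ) (a : ℕ → ℕ) : Prop :=
  IsExpansionOf q x a ∧ InfiniteSeq a ∧
    ∀ c, IsExpansionOf q x c → InfiniteSeq c → LexLe c a

/-- The quasi-greedy expansion of `x` in base `q`; by convention it is the zero
sequence whenever no infinite expansion exists (in particular for `x = 0`). -/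
def quasiGreedy (q x : ℝ) : ℕ → ℕ :=
  if h : ∃ a, IsQuasiGreedyOf q x a then h.choose else fun _ => 0

/-- The greedy expansion of `x` in base `q` (zero sequence if `x` has no expansion). -/
def greedy (q x : ℝ) : ℕ → ℕ :=
  if h : ∃ b, IsGreedyOf q x b then h.choose else fun _ => 0

/-- The interval `J_q = [0, α₁/(q-1)]`. -/
def Jq (q : ℝ) : Set ℝ := Set.Icc 0 ((alphaOne q : ℝ) / (q - 1))

/-- `U_q`: the set of real numbers having exactly one expansion in base `q`. -/
def Uq (q : ℝ) : Set ℝ := {x | ∃! c, IsExpansionOf q x c}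

/-- `U_q'`: the set of univoque sequences in base `q`. -/
def UqSeq (q : ℝ) : Set (ℕ → ℕ) := {c | ∃ x ∈ Uq q, IsExpansionOf q x c}

/-- `U`: the set of univoque numbers. -/
def USet : Set ℝ := {q | 1 < q ∧ ∃! c, IsExpansionOf q 1 c}

/-- `V_q`: the set of `x ∈ J_q` such that for every `n ≥ 1` with `a_n(x) > 0` the
conjugated shifted quasi-greedy expansion is lexicographically at most `(α_i)`. -/
def Vq (q : ℝ) : Set ℝ :=
  {x | x ∈ Jq q ∧ ∀ n, 0 < quasiGreedy q x n →
    LexLe (fun i => alphaOne q - quasiGreedy q x (n + 1 + i)) (quasiGreedy q 1)}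

/-- `V`: the set of `q > 1` whose quasi-greedy expansion `(α_i)` of `1` satisfies
`(α₁ - α_{k+i})_{i≥1} ≤ (α_i)_{i≥1}` lexicographically for all `k ≥ 1`. -/
def VSet : Set ℝ :=
  {q | 1 < q ∧ ∀ k, LexLe (fun i => alphaOne q - quasiGreedy q 1 (k + 1 + i)) (quasiGreedy q 1)}

/-- `q` is stable from above: some `s > q` has the same set of univoque sequences. -/
def StableFromAbove (q : ℝ) : Prop := ∃ s, q < s ∧ UqSeq q = UqSeq s

/-- `q` is stable from below: some `s ∈ (1, q)` has the same set of univoque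
sequences. -/
def StableFromBelow (q : ℝ) : Prop := ∃ s, 1 < s ∧ s < q ∧ UqSeq s = UqSeq q

namespace Univoque

/-! ### Sequences and the lexicographic order -/

/-- The sequence `c` with its first `k` terms removed. -/
def shift (k : ℕ) (c : ℕ → ℕ) : ℕ → ℕ := fun i => c (k + i)

/-- The reflection of `c` with respect to the alphabet `{0, …, A}`. -/
def conj (A : ℕ) (c : ℕ → ℕ) : ℕ → ℕ := fun i => A - c i

theorem shift_apply (k : ℕ) (c : ℕ → ℕ) (i : ℕ) : shift k c i = c (k + i) := rfl

theorem conj_apply (A : ℕ) (c : ℕ → ℕ) (i : ℕ) : conj A c i = A - c i := rfl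

theorem shift_shift (j k : ℕ) (c : ℕ → ℕ) : shift j (shift k c) = shift (k + j) c := by
  funext i; simp only [shift_apply, add_assoc]

theorem shift_zero (c : ℕ → ℕ) : shift 0 c = c := by
  funext i; simp [shift_apply]

theorem conj_shift (A k : ℕ) (c : ℕ → ℕ) : conj A (shift k c) = shift k (conj A c) := rfl

theorem conj_le (A : ℕ) (c : ℕ → ℕ) (i : ℕ) : conj A c i ≤ A := Nat.sub_le _ _

theorem conj_conj {A : ℕ} {c : ℕ → ℕ} (hc : ∀ i, c i ≤ A) : conj A (conj A c) = c := by
  funext i; have := hc i; simp only [conj_apply]; omega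

theorem _root_.LexLe.iff_toLex {a b : ℕ → ℕ} : LexLe a b ↔ toLex a ≤ toLex b :=
  (le_iff_lt_or_eq (a := toLex a) (b := toLex b)).symm

theorem not_lexLt {a b : ℕ → ℕ} : ¬ LexLt a b ↔ LexLe b a :=
  (not_lt (a := toLex a) (b := toLex b)).trans LexLe.iff_toLex.symm

theorem not_lexLe {a b : ℕ → ℕ} : ¬ LexLe a b ↔ LexLt b a := by
  rw [← not_lexLt, not_not]

theorem _root_.LexLe.refl (a : ℕ → ℕ) : LexLe a a := Or.inr rfl

theorem _root_.LexLt.le {a b : ℕ → ℕ} (h : LexLt a b) : LexLe a b := Or.inl h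

theorem _root_.LexLt.irrefl {a : ℕ → ℕ} : ¬ LexLt a a := not_lexLt.2 (LexLe.refl a)

theorem _root_.LexLt.trans_le {a b c : ℕ → ℕ} (h : LexLt a b) (h' : LexLe b c) : LexLt a c :=
  lt_of_lt_of_le (a := toLex a) (b := toLex b) (c := toLex c) h (LexLe.iff_toLex.1 h')

theorem _root_.LexLe.trans_lt {a b c : ℕ → ℕ} (h : LexLe a b) (h' : LexLt b c) : LexLt a c :=
  lt_of_le_of_lt (a := toLex a) (b := toLex b) (c := toLex c) (LexLe.iff_toLex.1 h) h'

theorem _root_.LexLe.trans {a b c : ℕ → ℕ} (h : LexLe a b) (h' : LexLe b c) : LexLe a c :=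
  LexLe.iff_toLex.2 ((LexLe.iff_toLex.1 h).trans (LexLe.iff_toLex.1 h'))

theorem _root_.LexLe.antisymm {a b : ℕ → ℕ} (h : LexLe a b) (h' : LexLe b a) : a = b :=
  toLex.injective (_root_.le_antisymm (LexLe.iff_toLex.1 h) (LexLe.iff_toLex.1 h'))

theorem _root_.LexLe.le_of_eq_below {a b : ℕ → ℕ} (h : LexLe a b) {m : ℕ}
    (hm : ∀ i < m, a i = b i) : a m ≤ b m := by
  rcases h with ⟨n, h1, h2⟩ | rfl
  · rcases lt_trichotomy m n with h | rfl | h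
    · exact (h1 m h).le
    · exact h2.le
    · exact absurd (hm n h) h2.ne
  · exact le_rfl

theorem lexLe_of_forall {a b : ℕ → ℕ} (h : ∀ m, (∀ i < m, a i = b i) → a m ≤ b m) :
    LexLe a b := by
  rw [← not_lexLt]
  rintro ⟨n, h1, h2⟩
  exact absurd (h n fun i hi => (h1 i hi).symm) (not_le.2 h2)

theorem _root_.LexLe.eq_below {a x b : ℕ → ℕ} (h : LexLe a x) (h' : LexLe x b) {k : ℕ}
    (hk : ∀ i < k, a i = b i) : ∀ i < k, x i = a i := by
  intro i
  induction i using Nat.strong_induction_on with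
  | _ i ih =>
    intro hi
    have h1 := h.le_of_eq_below (m := i) fun j hj => (ih j hj (hj.trans hi)).symm
    have h2 := h'.le_of_eq_below (m := i) fun j hj =>
      (ih j hj (hj.trans hi)).trans (hk j (hj.trans hi))
    have := hk i hi
    omega

theorem _root_.LexLe.eq_below_right {a b : ℕ → ℕ} {A k : ℕ} (h : LexLe a b) (ha : ∀ i < k, a i = A)
    (hb : ∀ i, b i ≤ A) : ∀ i < k, b i = A := by
  intro i
  induction i using Nat.strong_induction_on with
  | _ i ih =>
    intro hi
    have h1 := h.le_of_eq_below (m := i) fun j hj =>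
      (ha j (hj.trans hi)).trans (ih j hj (hj.trans hi)).symm
    have := ha i hi
    have := hb i
    omega

theorem _root_.LexLt.shift {a b : ℕ → ℕ} (h : LexLt a b) {k : ℕ} (hk : ∀ i < k, a i = b i) :
    LexLt (shift k a) (shift k b) := by
  obtain ⟨n, h1, h2⟩ := h
  have hn : k ≤ n := by
    by_contra hlt
    exact absurd (hk n (by omega)) h2.ne
  refine ⟨n - k, fun i hi => h1 _ (by omega), ?_⟩
  simpa only [shift_apply, Nat.add_sub_cancel' hn] using h2

theorem _root_.LexLe.shift {a b : ℕ → ℕ} (h : LexLe a b) {k : ℕ} (hk : ∀ i < k, a i = b i) :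
    LexLe (shift k a) (shift k b) := by
  rcases h with h | rfl
  · exact (LexLt.shift h hk).le
  · exact LexLe.refl _

theorem _root_.LexLt.of_shift_one {a b : ℕ → ℕ} (h0 : a 0 = b 0)
    (h : LexLt (Univoque.shift 1 a) (Univoque.shift 1 b)) : LexLt a b := by
  obtain ⟨n, h1, h2⟩ := h
  refine ⟨1 + n, fun i hi => ?_, h2⟩
  rcases i with _ | i
  · exact h0
  · simpa only [shift_apply, add_comm] using h1 i (by omega)

theorem _root_.LexLe.of_shift_one {a b : ℕ → ℕ} (h0 : a 0 = b 0)
    (h : LexLe (Univoque.shift 1 a) (Univoque.shift 1 b)) : LexLe a b := by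
  rcases h with h | h
  · exact (LexLt.of_shift_one h0 h).le
  · refine Or.inr (funext fun i => ?_)
    rcases i with _ | i
    · exact h0
    · simpa only [shift_apply, add_comm] using congrFun h i

theorem _root_.LexLt.conj {A : ℕ} {a b : ℕ → ℕ} (hb : ∀ i, b i ≤ A) (h : LexLt a b) :
    LexLt (conj A b) (conj A a) := by
  obtain ⟨n, h1, h2⟩ := h
  refine ⟨n, fun i hi => by simp only [conj_apply, h1 i hi], ?_⟩
  have := hb n
  simp only [conj_apply]
  omega

theorem zero_lexLe (a : ℕ → ℕ) : LexLe (fun _ => 0) a :=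
  lexLe_of_forall fun _ _ => Nat.zero_le _

/-! ### Sequences admissible with respect to a bounding sequence -/

/-- Every tail of `c` that follows a digit smaller than `A` is lexicographically smaller
than `α`. -/
def Adm (A : ℕ) (α c : ℕ → ℕ) : Prop := ∀ n, c n < A → LexLt (shift (n + 1) c) α

/-- The lexicographic description of univoque sequences: `c` has digits in `{0, …, A}`, and both
`c` and its reflection are admissible with respect to `α`. -/
def Bounded (A : ℕ) (α c : ℕ → ℕ) : Prop :=
  (∀ i, c i ≤ A) ∧ Adm A α c ∧ Adm A α (conj A c)

theorem Bounded.mono {A : ℕ} {α α' c : ℕ → ℕ} (h : LexLe α α') (hc : Bounded A α c) :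
    Bounded A α' c :=
  ⟨hc.1, fun n hn => (hc.2.1 n hn).trans_le h, fun n hn => (hc.2.2 n hn).trans_le h⟩

theorem Bounded.conj {A : ℕ} {α c : ℕ → ℕ} (hc : Bounded A α c) : Bounded A α (conj A c) :=
  ⟨conj_le A c, hc.2.2, by rw [conj_conj hc.1]; exact hc.2.1⟩

/-- The sequence `0 γ`. -/
def consZero (γ : ℕ → ℕ) : ℕ → ℕ := fun i => if i = 0 then 0 else γ (i - 1)

theorem shift_consZero (k : ℕ) (γ : ℕ → ℕ) : shift (k + 1) (consZero γ) = shift k γ := by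
  funext i
  have : k + 1 + i - 1 = k + i := by omega
  simp [shift_apply, consZero, this]

theorem bounded_consZero {A : ℕ} {α γ : ℕ → ℕ} (hγ : ∀ i, γ i ≤ A)
    (h1 : ∀ k, LexLe (shift k γ) γ) (h2 : ∀ k, LexLe (conj A (shift (k + 1) γ)) γ)
    (h : LexLt γ α) : Bounded A α (consZero γ) := by
  refine ⟨fun i => ?_, fun n _ => ?_, fun n hn => ?_⟩
  · unfold consZero; split_ifs
    · exact Nat.zero_le _
    · exact hγ _
  · rw [shift_consZero]; exact (h1 n).trans_lt h
  · rcases n with _ | n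
    · simp [conj_apply, consZero] at hn
    · rw [← conj_shift, shift_consZero]; exact (h2 n).trans_lt h

theorem not_bounded_consZero {A : ℕ} {α γ : ℕ → ℕ} (hA : 0 < A) (h : LexLe α γ) :
    ¬ Bounded A α (consZero γ) := by
  intro hb
  have := hb.2.1 0 (by simpa [consZero] using hA)
  rw [shift_consZero, shift_zero] at this
  exact LexLt.irrefl (this.trans_le h)

/-! ### Sequences dominating their tails -/

/-- `α` has digits in `{0, …, A}`, starts with `A ≥ 1` and dominates all its tails. -/
structure Dominant (A : ℕ) (α : ℕ → ℕ) : Prop where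
  pos : 0 < A
  zero : α 0 = A
  le : ∀ i, α i ≤ A
  shift_le : ∀ k, LexLe (shift k α) α

namespace Dominant

variable {A : ℕ} {α : ℕ → ℕ}

theorem conj_self_lt (h : Dominant A α) : LexLt (conj A α) α := by
  refine ⟨0, fun i hi => absurd hi (Nat.not_lt_zero i), ?_⟩
  have := h.pos
  simp only [conj_apply, h.zero]
  omega

theorem exists_pos_of_le (h : Dominant A α) (hk : ∃ k, LexLe α (conj A (shift k α))) :
    ∃ k, 0 < α k ∧ LexLe α (conj A (shift (k + 1) α)) := by
  classical
  obtain ⟨k, hk0⟩ : ∃ k, Nat.find hk = k + 1 := by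
    refine Nat.exists_eq_succ_of_ne_zero fun h0 => ?_
    have := Nat.find_spec hk
    rw [h0, shift_zero] at this
    exact LexLt.irrefl (h.conj_self_lt.trans_le this)
  have hspec := Nat.find_spec hk
  rw [hk0] at hspec
  refine ⟨k, Nat.pos_of_ne_zero fun h0 => ?_, hspec⟩
  refine Nat.find_min hk (m := k) (by omega) (LexLe.of_shift_one ?_ ?_)
  · simp [conj_apply, shift_apply, h0, h.zero]
  · rw [← conj_shift, shift_shift]
    exact (h.shift_le 1).trans hspec

theorem exists_pos_of_lt (h : Dominant A α) (hk : ∃ k, LexLt α (conj A (shift k α))) :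
    ∃ k, 0 < α k ∧ LexLt α (conj A (shift (k + 1) α)) := by
  classical
  obtain ⟨k, hk0⟩ : ∃ k, Nat.find hk = k + 1 := by
    refine Nat.exists_eq_succ_of_ne_zero fun h0 => ?_
    have := Nat.find_spec hk
    rw [h0, shift_zero] at this
    exact LexLt.irrefl (h.conj_self_lt.trans_le this.le)
  have hspec := Nat.find_spec hk
  rw [hk0] at hspec
  refine ⟨k, Nat.pos_of_ne_zero fun h0 => ?_, hspec⟩
  refine Nat.find_min hk (m := k) (by omega) (LexLt.of_shift_one ?_ ?_)
  · simp [conj_apply, shift_apply, h0, h.zero]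
  · rw [← conj_shift, shift_shift]
    exact (h.shift_le 1).trans_lt hspec

/-- A bounding sequence one of whose reflected tails is not smaller than itself can be lowered
slightly without changing the set of bounded sequences. -/
theorem bounded_of_agree (h : Dominant A α) {k : ℕ} (hk : 0 < α k)
    (hv : LexLe α (Univoque.conj A (shift (k + 1) α))) {α' : ℕ → ℕ}
    (ha : ∀ i < k + 1, α' i = α i) {c : ℕ → ℕ} (hc : Bounded A α c) : Bounded A α' c := by
  have key : ∀ c, Bounded A α c → Adm A α' c := by
    intro c hc n hn
    by_contra hlt
    have h1 := not_lexLt.1 hlt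
    have h2 := hc.2.1 n hn
    have h3 : ∀ i < k + 1, Univoque.shift (n + 1) c i = α i := fun i hi =>
      (h1.eq_below h2.le ha i hi).trans (ha i hi)
    have h4 := (h2.shift h3).conj (A := A) fun i => h.le _
    rw [shift_shift, conj_shift A (n + 1 + (k + 1))] at h4
    have h5 := hc.2.2 (n + 1 + k) (by
      have := h3 k (by omega)
      have := h.pos
      simp only [shift_apply] at *
      simp only [conj_apply]
      omega)
    exact LexLt.irrefl ((hv.trans_lt h4).trans_le h5.le)
  refine ⟨hc.1, key c hc, key _ hc.conj⟩

end Dominant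

/-- If `α` is strictly dominated by one of its reflected tails, then a bounding sequence sharing a
long prefix with `α` gives the same bounded sequences. -/
theorem bounded_of_agree_long {A k m : ℕ} {α : ℕ → ℕ} (hk : 0 < α k)
    (hm : ∀ i < m, α i = Univoque.conj A (shift (k + 1) α) i)
    (hm' : α m < Univoque.conj A (shift (k + 1) α) m) {α' : ℕ → ℕ}
    (ha : ∀ i < k + m + 2, α' i = α i) {c : ℕ → ℕ} (hc : Bounded A α' c) : Bounded A α c := by
  have key : ∀ c, Bounded A α' c → Adm A α c := by
    intro c hc n hn
    by_contra hlt
    have h1 := not_lexLt.1 hlt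
    have h2 := hc.2.1 n hn
    have h3 : ∀ i < k + m + 2, c (n + 1 + i) = α i := fun i hi =>
      h1.eq_below h2.le (fun i hi => (ha i hi).symm) i hi
    have h5 := hc.2.2 (n + 1 + k) (by
      have := h3 k (by omega)
      have := hc.1 (n + 1 + k)
      simp only [conj_apply]
      omega)
    refine LexLt.irrefl (h5.trans_le (LexLt.le ⟨m, fun i hi => ?_, ?_⟩))
    · have e1 := hm i hi
      have e2 := h3 (k + 1 + i) (by omega)
      have e3 := ha i (by omega)
      simp only [shift_apply, conj_apply] at *
      rw [e3, e1, ← e2]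
      congr 2
      ring
    · have e2 := h3 (k + 1 + m) (by omega)
      have e3 := ha m (by omega)
      simp only [shift_apply, conj_apply] at *
      rw [e3]
      refine hm'.trans_eq ?_
      rw [← e2]
      congr 2
      ring
  exact ⟨hc.1, key c hc, key _ hc.conj⟩

/-- If `α` is periodic and strictly dominated by one of its reflected tails, then a bounding
sequence that starts with the period of `α` increased by one in its last digit, followed by a
long block of zeros, gives the same bounded sequences. -/
theorem bounded_of_period {A k p : ℕ} {α : ℕ → ℕ} (hk : 0 < α k)
    (hv : LexLt α (Univoque.conj A (shift (k + 1) α)))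
    (hp : Univoque.shift (p + 1) α = α) {α' : ℕ → ℕ} (hα' : ∀ i, α' i ≤ A)
    (ha : ∀ i < p, α' i = α i) (hap : α' p = α p + 1)
    (hz : ∀ i < p + 2, α' (p + 1 + i) = 0) {c : ℕ → ℕ} (hc : Bounded A α' c) :
    Bounded A α c := by
  have hA : 0 < A := by have := hα' p; omega
  have step : ∀ c, Bounded A α' c → ∀ n, c n < A → LexLe α (shift (n + 1) c) →
      (∀ i < p + 1, c (n + 1 + i) = α i) := by
    intro c hc n hn h1
    have h2 := hc.2.1 n hn
    have h3 : ∀ i < p, c (n + 1 + i) = α i := fun i hi =>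
      h1.eq_below h2.le (fun i hi => (ha i hi).symm) i hi
    have h4 := h1.le_of_eq_below (m := p) fun i hi => (h3 i hi).symm
    have h5 := h2.le.le_of_eq_below (m := p) fun i hi => (h3 i hi).trans (ha i hi).symm
    simp only [shift_apply] at h4 h5
    have h6 : c (n + 1 + p) ≠ α p + 1 := by
      intro h6
      have h7 : ∀ i < p + 1, Univoque.shift (n + 1) c i = α' i := by
        intro i hi
        rcases Nat.lt_succ_iff_lt_or_eq.1 hi with hi | rfl
        · exact (h3 i hi).trans (ha i hi).symm
        · exact h6.trans hap.symm
      have h8 := h2.shift h7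
      rw [shift_shift] at h8
      have h9 := (zero_lexLe (Univoque.shift (n + 1 + (p + 1)) c)).eq_below h8.le
        (k := p + 2) fun i hi => (hz i hi).symm
      have h10 := hc.2.2 (n + 1 + p) (by simp only [conj_apply]; omega)
      have h11 := h10.le.eq_below_right (A := A) (k := p + 2) (fun i hi => by
        have := h9 i hi
        simp only [shift_apply, conj_apply] at *
        rw [show n + 1 + p + 1 + i = n + 1 + (p + 1) + i by ring, this, Nat.sub_zero]) hα'
        (p + 1) (by omega)
      have h12 := hz 0 (by omega)
      simp only [add_zero] at h12
      omega
    intro i hi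
    rcases Nat.lt_succ_iff_lt_or_eq.1 hi with hi | rfl
    · exact h3 i hi
    · omega
  have all : ∀ i, ∀ c, Bounded A α' c → ∀ n, c n < A → LexLe α (shift (n + 1) c) →
      c (n + 1 + i) = α i := by
    intro i
    induction i using Nat.strong_induction_on with
    | _ i ih =>
      intro c hc n hn h1
      have h2 := step c hc n hn h1
      rcases lt_or_ge i (p + 1) with hi | hi
      · exact h2 i hi
      · have h3 := LexLe.shift h1 (k := p + 1) fun i hi => (h2 i hi).symm
        rw [hp, shift_shift] at h3
        have h4 := ih (i - (p + 1)) (by omega) c hc (n + 1 + p) (by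
          rw [h2 p (by omega)]; have := hα' p; omega) h3
        have h5 := congrFun hp (i - (p + 1))
        simp only [shift_apply] at h5
        rw [show p + 1 + (i - (p + 1)) = i by omega] at h5
        rw [h5, ← h4]
        congr 1
        omega
  have key : ∀ c, Bounded A α' c → Adm A α c := by
    intro c hc n hn
    by_contra hlt
    have h1 := not_lexLt.1 hlt
    have h2 : Univoque.shift (n + 1) c = α := funext fun i => all i c hc n hn h1
    have e : Univoque.conj A (Univoque.shift (k + 1) α)
        = Univoque.shift (n + 1 + k + 1) (Univoque.conj A c) := by
      rw [← h2, shift_shift, conj_shift]; rfl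
    rw [e] at hv
    have h3 : Univoque.shift (n + 1 + k + 1) (Univoque.conj A c) = α :=
      funext fun i => all i _ hc.conj (n + 1 + k) (by
        have := congrFun h2 k
        have := hc.1 (n + 1 + k)
        simp only [shift_apply, conj_apply] at *
        omega) hv.le
    rw [h3] at hv
    exact LexLt.irrefl hv
  exact ⟨hc.1, key c hc, key _ hc.conj⟩

/-! ### Lowering a prefix -/

/-- `x` starts with the first `N` digits of `α`, the last of them being decreased by one. -/
structure Lowered (α : ℕ → ℕ) (N : ℕ) (x : ℕ → ℕ) : Prop where
  eq : ∀ i, i + 1 < N → x i = α i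
  last : ∀ i, i + 1 = N → x i + 1 = α i

namespace Lowered

variable {A N : ℕ} {α x : ℕ → ℕ}

theorem lexLt (h : Lowered α N x) (hN : 0 < N) : LexLt x α := by
  obtain ⟨n, rfl⟩ := Nat.exists_eq_succ_of_ne_zero hN.ne'
  refine ⟨n, fun i hi => h.eq i (by omega), ?_⟩
  have := h.last n rfl
  omega

theorem shift_lt (h : Lowered α N x) (hα : ∀ k, LexLe (shift k α) α) {k : ℕ} (hk : 0 < k)
    (hkN : k < N) : LexLt (shift k x) x := by
  by_contra hlt
  have h1 := not_lexLt.1 hlt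
  have h2 : ∀ i, k + i + 1 < N → α (k + i) = α i := by
    intro i
    induction i using Nat.strong_induction_on with
    | _ i ih =>
      intro hi
      have h3 := (hα k).le_of_eq_below (m := i) fun j hj => ih j hj (by omega)
      have h4 := h1.le_of_eq_below (m := i) fun j hj => by
        have := ih j hj (by omega)
        rw [shift_apply, h.eq j (by omega), h.eq (k + j) (by omega), this]
      rw [shift_apply, h.eq i (by omega), h.eq (k + i) (by omega)] at h4
      rw [shift_apply] at h3
      omega
  obtain ⟨i, hi⟩ : ∃ i, k + i + 1 = N := ⟨N - k - 1, by omega⟩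
  have h3 := (hα k).le_of_eq_below (m := i) fun j hj => h2 j (by omega)
  have h4 := h1.le_of_eq_below (m := i) fun j hj => by
    rw [shift_apply, h.eq j (by omega), h.eq (k + j) (by omega), h2 j (by omega)]
  have h5 := h.last (k + i) hi
  rw [shift_apply] at h3 h4
  rw [h.eq i (by omega)] at h4
  omega

end Lowered

/-- For each `k`, the reflected tail `conj A (shift k α)` first differs from `α` at the
index `d k`, where it is smaller. -/
def FirstDiff (A : ℕ) (α : ℕ → ℕ) (d : ℕ → ℕ) : Prop :=
  ∀ k, (∀ i < d k, A - α (k + i) = α i) ∧ A - α (k + d k) < α (d k)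

theorem exists_firstDiff {A : ℕ} {α : ℕ → ℕ} (h : ∀ k, LexLt (conj A (shift k α)) α) :
    ∃ d, FirstDiff A α d := by
  choose d hd using h
  exact ⟨d, hd⟩

namespace FirstDiff

variable {A : ℕ} {α d : ℕ → ℕ}

theorem eq_of (h : FirstDiff A α d) {k i : ℕ} (h1 : ∀ j < i, A - α (k + j) = α j)
    (h2 : A - α (k + i) < α i) : d k = i := by
  rcases lt_trichotomy (d k) i with hlt | heq | hlt
  · exact absurd (h1 _ hlt) (h k).2.ne
  · exact heq
  · exact absurd ((h k).1 _ hlt) h2.ne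

/-- The index intervals on which reflected tails agree with `α` are nested. -/
theorem nested (h : FirstDiff A α d) (hα : Dominant A α) {k t : ℕ} (ht : t ≤ d k) :
    t + d (k + t) ≤ d k := by
  by_contra hlt
  obtain ⟨l, hl⟩ := Nat.exists_eq_add_of_le ht
  have h1 := fun i (hi : i < l + 1) => (h (k + t)).1 i (by omega)
  have h2 : ∀ i < l, α (t + i) = α i := fun i hi => by
    rw [← h1 i (by omega), ← (h k).1 (t + i) (by omega), add_assoc]
  have h3 := (hα.shift_le t).le_of_eq_below (m := l) h2
  have h4 := h1 l (by omega)
  have h5 := (h k).2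
  rw [hl] at h5
  rw [shift_apply] at h3
  rw [add_assoc] at h4
  omega

/-- There are arbitrarily long prefixes of `α` inside which every reflected tail of `α` has
already become smaller than `α`. -/
theorem exists_good (h : FirstDiff A α d) (hα : Dominant A α) (M : ℕ) :
    ∃ N, M ≤ N ∧ ∀ k < N, k + d k < N := by
  let N := max M ((Finset.range M).sup fun k => k + d k + 1)
  refine ⟨N, le_max_left _ _, fun k hk => ?_⟩
  have hN : ∀ j < M, j + d j + 1 ≤ N := fun j hj =>
    (Finset.le_sup (f := fun k => k + d k + 1) (Finset.mem_range.2 hj)).trans (le_max_right _ _)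
  rcases lt_or_ge k M with hkM | hkM
  · exact hN k hkM
  · have hNe : N = (Finset.range M).sup fun k => k + d k + 1 := by
      rcases max_choice M ((Finset.range M).sup fun k => k + d k + 1) with h1 | h1
      · exact absurd (hk.trans_eq h1) (not_lt.2 hkM)
      · exact h1
    obtain ⟨j, hj, hj'⟩ : ∃ j ∈ Finset.range M, (Finset.range M).sup (fun k => k + d k + 1)
        = j + d j + 1 := by
      refine Finset.exists_mem_eq_sup _ (Finset.nonempty_range_iff.2 fun h0 => ?_) _
      rw [hNe, h0] at hk
      simp at hk
    have hj := Finset.mem_range.1 hj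
    rw [← hNe] at hj'
    have := h.nested hα (k := j) (t := k - j) (by omega)
    rw [show j + (k - j) = k by omega] at this
    omega

/-- The periodic sequence obtained by repeating a lowered good prefix dominates its reflected
tails. -/
theorem conj_shift_le_of_periodic (h : FirstDiff A α d) (hα : Dominant A α) {N : ℕ} (hN : 2 ≤ N)
    (hd : ∀ k < N, k + d k < N) {x : ℕ → ℕ} (hx : Lowered α N x) (hper : shift N x = x) (k : ℕ) :
    LexLe (conj A (shift k x)) x := by
  have hper' : ∀ i, x (N + i) = x i := fun i => congrFun hper i
  have hmul : ∀ t i, x (N * t + i) = x i := by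
    intro t i
    induction t with
    | zero => simp
    | succ t ih => rw [← ih, ← hper' (N * t + i)]; congr 1; ring
  have hx0 : x 0 = A := by rw [hx.eq 0 (by omega), hα.zero]
  have hle : ∀ k, k + 1 < N → x k ≤ A := fun k hk => by rw [hx.eq k hk]; exact hα.le k
  have main : ∀ m k, k < N → (∀ j < m, A - x (k + j) = x j) → A - x (k + m) ≤ x m := by
    intro m
    induction m using Nat.strong_induction_on with
    | _ m ih =>
      intro k hk hag
      rcases Nat.eq_zero_or_pos k with rfl | hk0
      · rcases Nat.eq_zero_or_pos m with rfl | hm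
        · rw [hx0]; omega
        · have := hag 0 hm
          have := hα.pos
          rw [add_zero, hx0] at *
          omega
      have hag' : ∀ j < m, k + j + 1 < N → A - α (k + j) = α j := fun j hj hj' => by
        rw [← hx.eq (k + j) hj', ← hx.eq j (by omega), hag j hj]
      have hdk := hd k hk
      rcases lt_trichotomy (k + m + 1) N with h1 | h1 | h1
      · rw [hx.eq _ h1, hx.eq m (by omega)]
        rcases lt_trichotomy (d k) m with h2 | h2 | h2
        · exact absurd (hag' _ h2 (by omega)) (h k).2.ne
        · rw [← h2]; exact (h k).2.le
        · exact ((h k).1 m h2).le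
      · have h2 : d k = m := by
          by_contra hne
          have h3 : d k < m := by omega
          exact absurd (hag' _ h3 (by omega)) (h k).2.ne
        have h3 := hx.last (k + m) h1
        have h4 := (h k).2
        rw [h2] at h4
        rw [hx.eq m (by omega)]
        omega
      · obtain ⟨l, rfl⟩ := Nat.exists_eq_add_of_le hk.le
        obtain ⟨m', rfl⟩ := Nat.exists_eq_add_of_le (show l ≤ m by omega)
        have h2 : ∀ j ≤ m', x (k + (l + j)) = x j := fun j _ => by
          rw [← add_assoc, hper']
        have h3 := ih m' (by omega) l (by omega) fun j hj => by
          have e1 := hag (l + j) (by omega)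
          rw [h2 j hj.le] at e1
          have e2 : x j ≤ A := by
            rw [← h2 j hj.le]
            by_contra h5
            have h6 : ∀ i, x i ≤ A := fun i => by
              rw [← Nat.div_add_mod i (k + l), hmul]
              have := Nat.mod_lt i (show 0 < k + l by omega)
              rcases Nat.lt_or_ge (i % (k + l) + 1) (k + l) with h7 | h7
              · exact hle _ h7
              · have := hx.last (i % (k + l)) (by omega)
                have := hα.le (i % (k + l))
                omega
            exact h5 (h6 _)
          omega
        rw [h2 m' le_rfl]
        omega
  refine lexLe_of_forall fun m hm => ?_
  have hkm : ∀ i, x (k + i) = x (k % N + i) := fun i => by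
    conv_lhs => rw [← Nat.div_add_mod k N, add_assoc, hmul]
  rw [conj_apply, shift_apply, hkm]
  refine main m (k % N) (Nat.mod_lt _ (by omega)) fun j hj => ?_
  rw [← hkm]
  exact hm j hj

end FirstDiff

/-- The periodic sequence whose period is the prefix of length `N` of `α` with last digit
decreased by one. -/
def lowerPeriodic (α : ℕ → ℕ) (N : ℕ) : ℕ → ℕ :=
  fun i => if i % N + 1 = N then α (i % N) - 1 else α (i % N)

/-- The prefix of length `N` of `α` with last digit decreased by one, followed by `γ`. -/
def lowerAppend (α : ℕ → ℕ) (N : ℕ) (γ : ℕ → ℕ) : ℕ → ℕ :=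
  fun i => if i + 1 < N then α i else if i + 1 = N then α i - 1 else γ (i - N)

theorem shift_lowerAppend (α γ : ℕ → ℕ) (N : ℕ) : shift N (lowerAppend α N γ) = γ := by
  funext i
  have h1 : ¬ N + i + 1 < N := by omega
  have h2 : ¬ N + i + 1 = N := by omega
  simp only [shift_apply, lowerAppend, if_neg h1, if_neg h2, Nat.add_sub_cancel_left]

theorem shift_lowerPeriodic (α : ℕ → ℕ) (N : ℕ) :
    shift N (lowerPeriodic α N) = lowerPeriodic α N := by
  funext i; simp [shift_apply, lowerPeriodic]

section

variable {A : ℕ} {α d : ℕ → ℕ} {N : ℕ}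

theorem lowerPeriodic_le (hα : Dominant A α) (i : ℕ) : lowerPeriodic α N i ≤ A := by
  unfold lowerPeriodic
  have := hα.le (i % N)
  split_ifs <;> omega

theorem FirstDiff.pos_last (hα : Dominant A α) (hd : FirstDiff A α d)
    (hN : ∀ k < N, k + d k < N) {i : ℕ} (hi : i + 1 = N) : 0 < α i := by
  have h1 := hN i (by omega)
  have h2 := (hd i).2
  rw [show d i = 0 by omega, hα.zero, add_zero] at h2
  omega

theorem lowered_lowerPeriodic (hα : Dominant A α) (hd : FirstDiff A α d)
    (hN : ∀ k < N, k + d k < N) :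
    Lowered α N (lowerPeriodic α N) := by
  constructor
  · intro i hi
    simp only [lowerPeriodic, Nat.mod_eq_of_lt (show i < N by omega), if_neg hi.ne]
  · intro i hi
    have := hd.pos_last hα hN hi
    simp only [lowerPeriodic, Nat.mod_eq_of_lt (show i < N by omega), if_pos hi]
    omega

theorem lowered_lowerAppend (hα : Dominant A α) (hd : FirstDiff A α d)
    (hN : ∀ k < N, k + d k < N) (γ : ℕ → ℕ) :
    Lowered α N (lowerAppend α N γ) := by
  constructor
  · intro i hi
    simp only [lowerAppend, if_pos hi]
  · intro i hi
    have := hd.pos_last hα hN hi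
    simp only [lowerAppend, if_neg (show ¬ i + 1 < N by omega), if_pos hi]
    omega

theorem lowerPeriodic_shift_le (hα : Dominant A α) (hd : FirstDiff A α d) (hN0 : 0 < N)
    (hN : ∀ k < N, k + d k < N) (k : ℕ) :
    LexLe (shift k (lowerPeriodic α N)) (lowerPeriodic α N) := by
  have h1 : shift k (lowerPeriodic α N) = shift (k % N) (lowerPeriodic α N) := by
    funext i; simp [shift_apply, lowerPeriodic]
  rw [h1]
  rcases Nat.eq_zero_or_pos (k % N) with h2 | h2
  · rw [h2, shift_zero]; exact LexLe.refl _
  · exact ((lowered_lowerPeriodic hα hd hN).shift_lt hα.shift_le h2 (Nat.mod_lt _ hN0)).le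

end

/-- If all reflected tails of `α` become smaller than `α` after at most `L` digits, then `α` can
be approximated from below by sequences that are strictly larger than their tails and their
reflected tails. -/
theorem exists_strict_approx {A : ℕ} {α d : ℕ → ℕ} (hα : Dominant A α) (hd : FirstDiff A α d)
    {L : ℕ} (hL : ∀ k, d k < L) (n : ℕ) :
    ∃ a : ℕ → ℕ, (∀ i < n, a i = α i) ∧ (∀ i, a i ≤ A) ∧ LexLt a α ∧
      (∀ k, LexLt (shift (k + 1) a) a) ∧ ∀ k, LexLt (conj A (shift (k + 1) a)) a := by
  obtain ⟨M, hLM, hM⟩ := hd.exists_good hα (L + 2)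
  obtain ⟨N, hMN, hN⟩ := hd.exists_good hα (M + 2 * L + n + 2)
  have hγ := lowered_lowerPeriodic hα hd hM
  have ha := lowered_lowerAppend hα hd hN (lowerPeriodic α M)
  have hγs := lowerPeriodic_shift_le hα hd (by omega) hM
  have hγc := hd.conj_shift_le_of_periodic hα (by omega) hM hγ (shift_lowerPeriodic α M)
  have hγle : ∀ i, lowerPeriodic α M i ≤ A := lowerPeriodic_le hα
  have has := shift_lowerAppend α (lowerPeriodic α M) N
  generalize lowerPeriodic α M = γ at *
  have hale : ∀ i, lowerAppend α N γ i ≤ A := by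
    intro i
    have := hα.le i
    have := hγle (i - N)
    unfold lowerAppend
    split_ifs <;> omega
  generalize lowerAppend α N γ = a at *
  have hγa : LexLt γ a := by
    refine ⟨M - 1, fun i hi => ?_, ?_⟩
    · rw [hγ.eq i (by omega), ha.eq i (by omega)]
    · have := hγ.last (M - 1) (by omega)
      rw [ha.eq (M - 1) (by omega)]
      omega
  have htail : ∀ k, N ≤ k → shift k a = shift (k - N) γ := fun k hk => by
    rw [← has, shift_shift, Nat.add_sub_cancel' hk]
  refine ⟨a, fun i hi => ha.eq i (by omega), hale, ha.lexLt (by omega), fun k => ?_, fun k => ?_⟩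
  · rcases lt_or_ge (k + 1) N with hk | hk
    · exact ha.shift_lt hα.shift_le k.succ_pos hk
    · rw [htail _ hk]
      exact (hγs _).trans_lt hγa
  · rcases lt_or_ge (k + 1) N with hk | hk
    swap
    · rw [htail _ hk]
      exact (hγc _).trans_lt hγa
    generalize hk' : k + 1 = j at *
    have h1 := hN j hk
    have h2 : ∀ i < d j, A - a (j + i) = a i := fun i hi => by
      rw [ha.eq (j + i) (by omega), ha.eq i (by omega)]
      exact (hd j).1 i hi
    have h3 := (hd j).2
    rcases Nat.lt_or_ge (j + d j + 1) N with h4 | h4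
    · exact ⟨d j, h2, by
        rwa [conj_apply, shift_apply, ha.eq _ h4, ha.eq (d j) (by omega)]⟩
    have h4 : j + d j + 1 = N := by omega
    have h5 := ha.last _ h4
    have h6 := ha.eq (d j) (by omega)
    rcases Nat.lt_or_ge (A - a (j + d j)) (a (d j)) with h7 | h7
    · exact ⟨d j, h2, h7⟩
    have h8 : A - a (j + d j) = a (d j) := by omega
    obtain ⟨l, hl⟩ : ∃ l, l = d j + 1 := ⟨_, rfl⟩
    have hlL := hL l
    have hjL := hL j
    have h9 : ∀ i, a (j + (l + i)) = γ i := fun i => by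
      rw [← has, shift_apply]; congr 1; omega
    have h10 : ∀ i ≤ d l, γ i = α i := fun i hi => hγ.eq i (by omega)
    have h11 : ∀ i ≤ d l, a (l + i) = α (l + i) := fun i hi => ha.eq _ (by omega)
    refine ⟨l + d l, fun i hi => ?_, ?_⟩
    · rw [conj_apply, shift_apply]
      rcases lt_trichotomy i (d j) with hi' | rfl | hi'
      · exact h2 i hi'
      · exact h8
      · obtain ⟨t, rfl⟩ := Nat.exists_eq_add_of_le (show l ≤ i by omega)
        rw [h9, h10 t (by omega), h11 t (by omega), ← (hd l).1 t (by omega)]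
        have := hα.le (l + t)
        omega
    · rw [conj_apply, shift_apply, h9, h10 _ le_rfl, h11 _ le_rfl]
      have := (hd l).2
      have := hα.le (l + d l)
      have := hα.le (d l)
      omega

/-! ### Values of digit sequences -/

/-- The number represented by the digit sequence `c` in base `q`. -/
def val (q : ℝ) (c : ℕ → ℕ) : ℝ := ∑' i, (c i : ℝ) / q ^ (i + 1)

section Value

variable {q : ℝ} {A : ℕ} {c : ℕ → ℕ}

theorem hasSum_const (hq : 1 < q) (a : ℝ) :
    HasSum (fun i : ℕ => a / q ^ (i + 1)) (a / (q - 1)) := by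
  have h := (hasSum_geometric_of_lt_one (r := q⁻¹) (by positivity)
    (inv_lt_one_of_one_lt₀ hq)).mul_left (a / q)
  have h0 : q ≠ 0 := by positivity
  have h1 : q - 1 ≠ 0 := by linarith
  have e1 : (fun i : ℕ => a / q ^ (i + 1)) = fun i : ℕ => a / q * q⁻¹ ^ i := by
    funext i; rw [pow_succ, inv_pow]; field_simp
  have e2 : a / (q - 1) = a / q * (1 - q⁻¹)⁻¹ := by
    rw [show (1 - q⁻¹) = (q - 1) / q by field_simp]; field_simp
  rw [e1, e2]
  exact h

theorem summable_digits (hq : 1 < q) (hc : ∀ i, c i ≤ A) :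
    Summable fun i => (c i : ℝ) / q ^ (i + 1) := by
  refine Summable.of_nonneg_of_le (fun i => by positivity) (fun i => ?_)
    (hasSum_const hq (A : ℝ)).summable
  have : (c i : ℝ) ≤ A := by exact_mod_cast hc i
  gcongr

theorem val_nonneg (hq : 1 < q) (c : ℕ → ℕ) : 0 ≤ val q c :=
  tsum_nonneg fun i => by positivity

theorem val_le (hq : 1 < q) (hc : ∀ i, c i ≤ A) : val q c ≤ A / (q - 1) := by
  rw [← (hasSum_const hq (A : ℝ)).tsum_eq]
  refine (summable_digits hq hc).tsum_le_tsum (fun i => ?_) (hasSum_const hq (A : ℝ)).summable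
  have : (c i : ℝ) ≤ A := by exact_mod_cast hc i
  gcongr

theorem val_conj (hq : 1 < q) (hc : ∀ i, c i ≤ A) :
    val q (conj A c) = A / (q - 1) - val q c := by
  have h := (hasSum_const hq (A : ℝ)).sub (summable_digits hq hc).hasSum
  refine Eq.trans ?_ h.tsum_eq
  unfold val
  congr 1
  funext i
  rw [conj_apply, Nat.cast_sub (hc i)]
  ring

theorem val_split (hq : 1 < q) (hc : ∀ i, c i ≤ A) (m : ℕ) :
    val q c = ∑ i ∈ Finset.range m, (c i : ℝ) / q ^ (i + 1) + val q (shift m c) / q ^ m := by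
  unfold val
  rw [← (summable_digits hq hc).sum_add_tsum_nat_add m, ← tsum_div_const]
  congr 2
  funext i
  rw [shift_apply, add_comm m i, div_div, ← pow_add]
  congr 2
  ring

theorem val_succ (hq : 1 < q) (hc : ∀ i, c i ≤ A) :
    q * val q c = c 0 + val q (shift 1 c) := by
  have h0 : q ≠ 0 := by positivity
  rw [val_split hq hc 1]
  simp
  field_simp

theorem val_shift_succ (hq : 1 < q) (hc : ∀ i, c i ≤ A) (k : ℕ) :
    q * val q (shift k c) = c k + val q (shift (k + 1) c) := by
  rw [val_succ hq (c := shift k c) fun i => hc _, shift_shift]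
  rfl

theorem val_pos (hq : 1 < q) (hc : ∀ i, c i ≤ A) {i : ℕ} (hi : c i ≠ 0) : 0 < val q c := by
  have : (0 : ℝ) < c i := by exact_mod_cast Nat.pos_of_ne_zero hi
  exact (summable_digits hq hc).tsum_pos (fun i => by positivity) i (by positivity)

theorem infiniteSeq_iff : InfiniteSeq c ↔ ∀ k, ∃ i, c (k + i) ≠ 0 := by
  unfold InfiniteSeq
  rw [← Nat.frequently_atTop_iff_infinite, Filter.frequently_atTop]
  refine forall_congr' fun k => ⟨?_, ?_⟩
  · rintro ⟨j, hj, h⟩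
    exact ⟨j - k, by rwa [Nat.add_sub_cancel' hj]⟩
  · rintro ⟨i, h⟩
    exact ⟨k + i, by omega, h⟩

theorem val_shift_pos (hq : 1 < q) (hc : ∀ i, c i ≤ A) (h : InfiniteSeq c) (k : ℕ) :
    0 < val q (shift k c) := by
  obtain ⟨i, hi⟩ := infiniteSeq_iff.1 h k
  exact val_pos hq (c := shift k c) (fun i => hc _) hi

/-- A sequence of bounded remainders determines an expansion. -/
theorem val_eq_of_remainders (hq : 1 < q) (hc : ∀ i, c i ≤ A) {r : ℕ → ℝ} {B : ℝ}
    (hr : ∀ i, r (i + 1) = q * r i - c i) (hB : ∀ i, |r i| ≤ B) : val q c = r 0 := by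
  have h0 : q ≠ 0 := by positivity
  have h1 : ∀ m, ∑ i ∈ Finset.range m, (c i : ℝ) / q ^ (i + 1) = r 0 - r m / q ^ m := by
    intro m
    induction m with
    | zero => simp
    | succ m ih => rw [Finset.sum_range_succ, ih, hr]; field_simp; ring
  have h2 : Filter.Tendsto (fun m => r m / q ^ m) Filter.atTop (nhds 0) := by
    have h3 : Filter.Tendsto (fun m : ℕ => B / q ^ m) Filter.atTop (nhds 0) :=
      tendsto_const_nhds.div_atTop (tendsto_pow_atTop_atTop_of_one_lt hq)
    refine squeeze_zero_norm (fun m => ?_) h3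
    rw [norm_div, norm_pow, Real.norm_eq_abs, Real.norm_of_nonneg (by linarith : 0 ≤ q)]
    have := hB m
    gcongr
  have h4 := (summable_digits hq hc).hasSum.tendsto_sum_nat
  simp_rw [h1] at h4
  have h5 := (tendsto_const_nhds (x := r 0)).sub h2
  rw [sub_zero] at h5
  exact tendsto_nhds_unique h4 h5

/-- Every number in `[0, A / (q - 1)]` has an expansion with digits in `{0, …, A}` as soon as
`q - 1 ≤ A`. -/
theorem exists_val_eq (hq : 1 < q) (hA : q - 1 ≤ A) {x : ℝ} (h0 : 0 ≤ x) (h1 : x ≤ A / (q - 1)) :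
    ∃ c : ℕ → ℕ, (∀ i, c i ≤ A) ∧ val q c = x := by
  have hq1 : 0 < q - 1 := by linarith
  let dig : ℝ → ℕ := fun y => min ⌊q * y⌋₊ A
  let r : ℕ → ℝ := fun n => Nat.rec x (fun _ y => q * y - dig y) n
  have hr : ∀ i, r (i + 1) = q * r i - dig (r i) := fun i => rfl
  have hb : ∀ i, 0 ≤ r i ∧ r i ≤ A / (q - 1) := by
    intro i
    induction i with
    | zero => exact ⟨h0, h1⟩
    | succ i ih =>
      obtain ⟨h2, h3⟩ := ih
      have h4 : 0 ≤ q * r i := by positivity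
      have h5 : (dig (r i) : ℝ) ≤ q * r i := by
        refine le_trans ?_ (Nat.floor_le h4)
        exact_mod_cast min_le_left _ _
      rw [hr]
      refine ⟨by linarith, ?_⟩
      rcases le_total ⌊q * r i⌋₊ A with h6 | h6
      · have h7 : dig (r i) = ⌊q * r i⌋₊ := min_eq_left h6
        have h8 := Nat.lt_floor_add_one (q * r i)
        rw [h7]
        have h9 : 1 ≤ (A : ℝ) / (q - 1) := by rw [le_div_iff₀ hq1]; linarith
        linarith
      · have h7 : dig (r i) = A := min_eq_right h6
        rw [h7]
        have h8 : (A : ℝ) / (q - 1) = q * (A / (q - 1)) - A := by field_simp; ring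
        rw [h8]
        gcongr
  refine ⟨fun i => dig (r i), fun i => min_le_right _ _, ?_⟩
  refine val_eq_of_remainders (A := A) (r := r) (B := A / (q - 1)) hq
    (fun i => min_le_right _ _) (fun i => hr i) fun i => ?_
  rw [abs_of_nonneg (hb i).1]
  exact (hb i).2

/-- Comparison of values at the first index where two sequences differ. -/
theorem val_sub_le (hq : 1 < q) {x a : ℕ → ℕ} (hx : ∀ i, x i ≤ A) (ha : ∀ i, a i ≤ A) {m : ℕ}
    (h : ∀ i < m, x i = a i) (hm : x m < a m) :
    val q x - val q a ≤ (val q (shift (m + 1) x) - 1 - val q (shift (m + 1) a)) / q ^ (m + 1) := by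
  have h0 : 0 < q := by linarith
  rw [val_split hq hx (m + 1), val_split hq ha (m + 1), Finset.sum_range_succ,
    Finset.sum_range_succ, Finset.sum_congr rfl fun i hi => by rw [h i (Finset.mem_range.1 hi)]]
  have h1 : (x m : ℝ) + 1 ≤ a m := by exact_mod_cast hm
  have h2 : ((x m : ℝ) + 1) / q ^ (m + 1) ≤ a m / q ^ (m + 1) := by gcongr
  rw [add_div] at h2
  rw [sub_div, sub_div]
  linarith

/-- If the sequences of a family are equal to `a`, or smaller than `a` with a remaining tail
again in the family, then their values do not exceed that of `a`. -/
theorem val_le_one_of_family (hq : 1 < q) {a : ℕ → ℕ} (ha : ∀ i, a i ≤ A) (h1 : val q a = 1)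
    {S : Set (ℕ → ℕ)} (hS : ∀ x ∈ S, ∀ i, x i ≤ A)
    (h : ∀ x ∈ S, x = a ∨ ∃ m, (∀ i < m, x i = a i) ∧ x m < a m ∧ shift (m + 1) x ∈ S) :
    ∀ x ∈ S, val q x ≤ 1 := by
  have h0 : 0 < q := by linarith
  have hC : 0 ≤ (A : ℝ) / (q - 1) := div_nonneg (by positivity) (by linarith)
  have main : ∀ n : ℕ, ∀ x ∈ S, val q x - 1 ≤ A / (q - 1) / q ^ n := by
    intro n
    induction n with
    | zero =>
      intro x hx
      have := val_le hq (hS x hx)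
      rw [pow_zero, div_one]
      linarith
    | succ n ih =>
      intro x hx
      rcases h x hx with rfl | ⟨m, h2, h3, h4⟩
      · rw [h1, sub_self]; positivity
      · have h5 := val_sub_le hq (hS x hx) ha h2 h3
        have h6 := val_nonneg hq (shift (m + 1) a)
        rw [h1] at h5
        refine h5.trans ?_
        have h7 : val q (shift (m + 1) x) - 1 - val q (shift (m + 1) a) ≤ A / (q - 1) / q ^ n := by
          linarith [ih _ h4]
        calc _ ≤ A / (q - 1) / q ^ n / q ^ (m + 1) := by gcongr
          _ ≤ A / (q - 1) / q ^ n / q ^ 1 := by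
            have : q ^ 1 ≤ q ^ (m + 1) := pow_le_pow_right₀ hq.le (by omega)
            gcongr
          _ = _ := by rw [div_div _ (q ^ n), ← pow_add]
  intro x hx
  have h3 : Filter.Tendsto (fun m : ℕ => A / (q - 1) / q ^ m) Filter.atTop (nhds 0) :=
    tendsto_const_nhds.div_atTop (tendsto_pow_atTop_atTop_of_one_lt hq)
  have := ge_of_tendsto' h3 fun n => main n x hx
  linarith

end Value

/-! ### The quasi-greedy expansion of `1` -/

/-- The remainders of the quasi-greedy algorithm for `1` in base `q`. -/
def rem (q : ℝ) : ℕ → ℝ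
  | 0 => 1
  | j + 1 => q * rem q j - ((⌈q * rem q j⌉ - 1).toNat : ℝ)

/-- The digits produced by the quasi-greedy algorithm for `1` in base `q`. -/
def qg (q : ℝ) (j : ℕ) : ℕ := (⌈q * rem q j⌉ - 1).toNat

theorem rem_succ (q : ℝ) (j : ℕ) : rem q (j + 1) = q * rem q j - qg q j := rfl

theorem qg_zero (q : ℝ) : qg q 0 = alphaOne q := by
  simp [qg, rem, alphaOne]

theorem toNat_ceil_sub_one {y : ℝ} (hy : 0 < y) :
    (((⌈y⌉ - 1).toNat : ℕ) : ℝ) < y ∧ y ≤ ((⌈y⌉ - 1).toNat : ℕ) + 1 := by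
  have h1 : 0 < ⌈y⌉ := Int.ceil_pos.2 hy
  have h2 : (((⌈y⌉ - 1).toNat : ℕ) : ℝ) = (⌈y⌉ : ℝ) - 1 := by
    have : (((⌈y⌉ - 1).toNat : ℕ) : ℤ) = ⌈y⌉ - 1 := Int.toNat_of_nonneg (by omega)
    exact_mod_cast congrArg (Int.cast (R := ℝ)) this
  rw [h2]
  exact ⟨by linarith [Int.ceil_lt_add_one y], by linarith [Int.le_ceil y]⟩

theorem eq_toNat_ceil_sub_one {y : ℝ} {n : ℕ} (h1 : (n : ℝ) < y) (h2 : y ≤ n + 1) :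
    (⌈y⌉ - 1).toNat = n := by
  have : ⌈y⌉ = (n : ℤ) + 1 := by
    rw [Int.ceil_eq_iff]; push_cast; exact ⟨by linarith, h2⟩
  omega

section QuasiGreedy

variable {q : ℝ}

theorem rem_mem (hq : 1 < q) (j : ℕ) : 0 < rem q j ∧ rem q j ≤ 1 := by
  induction j with
  | zero => simp [rem]
  | succ j ih =>
    have h := toNat_ceil_sub_one (y := q * rem q j) (mul_pos (by linarith) ih.1)
    rw [rem_succ]
    unfold qg
    exact ⟨by linarith [h.1], by linarith [h.2]⟩

theorem qg_lt (hq : 1 < q) (j : ℕ) : (qg q j : ℝ) < q * rem q j := by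
  have := (rem_mem hq (j + 1)).1
  rw [rem_succ] at this
  linarith

theorem le_qg_add_one (hq : 1 < q) (j : ℕ) : q * rem q j ≤ qg q j + 1 := by
  have := (rem_mem hq (j + 1)).2
  rw [rem_succ] at this
  linarith

theorem qg_le (hq : 1 < q) (j : ℕ) : qg q j ≤ alphaOne q := by
  rw [← qg_zero]
  have h1 := qg_lt hq j
  have h2 := le_qg_add_one hq 0
  have h3 := (rem_mem hq j).2
  have h4 : rem q 0 = 1 := rfl
  have h5 : (qg q j : ℝ) < qg q 0 + 1 := by nlinarith
  exact Nat.lt_succ_iff.1 (by exact_mod_cast h5)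

theorem val_qg (hq : 1 < q) : val q (qg q) = 1 := by
  refine val_eq_of_remainders (r := rem q) (B := 1) hq (qg_le hq) (rem_succ q) fun i => ?_
  rw [abs_of_pos (rem_mem hq i).1]
  exact (rem_mem hq i).2

theorem val_shift_qg (hq : 1 < q) (k : ℕ) : val q (shift k (qg q)) = rem q k := by
  refine val_eq_of_remainders (r := fun i => rem q (k + i)) (B := 1) hq
    (fun i => qg_le hq (k + i)) (fun i => rem_succ q (k + i)) fun i => ?_
  rw [abs_of_pos (rem_mem hq _).1]
  exact (rem_mem hq _).2

theorem infiniteSeq_qg (hq : 1 < q) : InfiniteSeq (qg q) := by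
  rw [infiniteSeq_iff]
  intro k
  by_contra! h
  have h1 : val q (shift k (qg q)) = 0 := by simp [val, shift_apply, h]
  rw [val_shift_qg hq] at h1
  exact (rem_mem hq k).1.ne' h1

theorem alphaOne_pos (hq : 1 < q) : 0 < alphaOne q := by
  rw [← qg_zero]
  have h2 := le_qg_add_one hq 0
  have h4 : rem q 0 = 1 := rfl
  rw [h4, mul_one] at h2
  have : (0 : ℝ) < qg q 0 := by linarith
  exact_mod_cast this

theorem sub_one_le_alphaOne (hq : 1 < q) : q - 1 ≤ alphaOne q := by
  rw [← qg_zero]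
  have h2 := le_qg_add_one hq 0
  have h4 : rem q 0 = 1 := rfl
  rw [h4, mul_one] at h2
  linarith

theorem rem_le_of_agree (hq : 1 < q) {k : ℕ} {j : ℕ} (h : ∀ i < j, qg q (k + i) = qg q i) :
    rem q (k + j) ≤ rem q j := by
  induction j with
  | zero => exact (rem_mem hq _).2
  | succ j ih =>
    rw [← add_assoc, rem_succ, rem_succ, h j (by omega)]
    have := ih fun i hi => h i (by omega)
    gcongr

theorem dominant_qg (hq : 1 < q) : Dominant (alphaOne q) (qg q) where
  pos := alphaOne_pos hq
  zero := qg_zero q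
  le := qg_le hq
  shift_le k := by
    refine lexLe_of_forall fun m hm => ?_
    have h1 := rem_le_of_agree hq hm
    have h2 := qg_lt hq (k + m)
    have h3 := le_qg_add_one hq m
    have h4 : (qg q (k + m) : ℝ) < qg q m + 1 := by nlinarith
    exact Nat.lt_succ_iff.1 (by exact_mod_cast h4)

theorem shift_qg_eq_iff (hq : 1 < q) {k : ℕ} : shift k (qg q) = qg q ↔ rem q k = 1 := by
  constructor
  · intro h
    rw [← val_shift_qg hq, h, val_qg hq]
  · intro h
    have h1 : ∀ j, rem q (k + j) = rem q j := by
      intro j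
      induction j with
      | zero => exact h
      | succ j ih => rw [← add_assoc, rem_succ, rem_succ, qg, qg, ih]
    funext j
    rw [shift_apply, qg, qg, h1]

/-- A sequence that is lexicographically larger than the quasi-greedy expansion of `1` has value
at least `1`, with a quantitative excess. -/
theorem exists_one_add_le_val (hq : 1 < q) {B : ℕ} {x : ℕ → ℕ} (hx : ∀ i, x i ≤ B)
    (h : LexLt (qg q) x) :
    ∃ m, 1 + val q (shift (m + 1) x) / q ^ (m + 1) ≤ val q x := by
  obtain ⟨m, h1, h2⟩ := h
  refine ⟨m, ?_⟩
  have h3 := val_sub_le (A := max B (alphaOne q)) hq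
    (fun i => (qg_le hq i).trans (le_max_right _ _))
    (fun i => (hx i).trans (le_max_left _ _)) h1 h2
  rw [val_qg hq, val_shift_qg hq] at h3
  have h4 := (rem_mem hq (m + 1)).2
  have h5 : (rem q (m + 1) - 1 - val q (shift (m + 1) x)) / q ^ (m + 1)
      ≤ (- val q (shift (m + 1) x)) / q ^ (m + 1) := by
    have : 0 < q := by linarith
    gcongr
    linarith
  rw [neg_div] at h5
  linarith

theorem one_le_val (hq : 1 < q) {B : ℕ} {x : ℕ → ℕ} (hx : ∀ i, x i ≤ B) (h : LexLe (qg q) x) :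
    1 ≤ val q x := by
  rcases h with h | rfl
  · obtain ⟨m, hm⟩ := exists_one_add_le_val hq hx h
    have := val_nonneg hq (shift (m + 1) x)
    have : 0 ≤ val q (shift (m + 1) x) / q ^ (m + 1) := by
      have : 0 < q := by linarith
      positivity
    linarith
  · rw [val_qg hq]

theorem isQuasiGreedyOf_qg (hq : 1 < q) : IsQuasiGreedyOf q 1 (qg q) := by
  refine ⟨⟨qg_le hq, (val_qg hq).symm⟩, infiniteSeq_qg hq, fun c hc hinf => ?_⟩
  by_contra hlt
  obtain ⟨m, hm⟩ := exists_one_add_le_val hq hc.1 (not_lexLe.1 hlt)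
  have h1 : val q c = 1 := hc.2.symm
  have h2 := val_shift_pos hq hc.1 hinf (m + 1)
  have h3 : 0 < val q (shift (m + 1) c) / q ^ (m + 1) := by
    have : 0 < q := by linarith
    positivity
  linarith

theorem quasiGreedy_one (hq : 1 < q) : quasiGreedy q 1 = qg q := by
  have h := isQuasiGreedyOf_qg hq
  have hex : ∃ a, IsQuasiGreedyOf q 1 a := ⟨_, h⟩
  have h2 : quasiGreedy q 1 = hex.choose := by rw [quasiGreedy, dif_pos hex]
  have h3 := hex.choose_spec
  rw [← h2] at h3
  exact (h.2.2 _ h3.1 h3.2.1).antisymm (h3.2.2 _ h.1 h.2.1)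

/-- A sequence of value `1` dominating its tails is the quasi-greedy expansion of `1`. -/
theorem qg_eq_of_dominant (hq : 1 < q) {B : ℕ} {a : ℕ → ℕ} (ha : ∀ i, a i ≤ B)
    (hinf : InfiniteSeq a) (h1 : val q a = 1) (hs : ∀ k, LexLe (shift k a) a) : qg q = a := by
  have h2 : ∀ k, val q (shift k a) ≤ 1 := fun k => by
    refine val_le_one_of_family hq ha h1 (S := Set.range fun k => shift k a) ?_ ?_ _ ⟨k, rfl⟩
    · rintro _ ⟨k, rfl⟩ i
      exact ha _
    · rintro _ ⟨k, rfl⟩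
      rcases hs k with ⟨m, h3, h4⟩ | h
      · exact Or.inr ⟨m, h3, h4, _, (shift_shift _ _ _).symm⟩
      · exact Or.inl h
  have key : ∀ k, rem q k = val q (shift k a) → qg q k = a k := fun k h => by
    have h4 := val_shift_succ hq ha k
    have h5 := val_shift_pos hq ha hinf (k + 1)
    have h6 := h2 (k + 1)
    refine eq_toNat_ceil_sub_one ?_ ?_ <;> rw [h] <;> linarith
  have h3 : ∀ k, rem q k = val q (shift k a) := by
    intro k
    induction k with
    | zero => rw [shift_zero, h1]; rfl
    | succ k ih =>
      have h4 := val_shift_succ hq ha k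
      rw [rem_succ, key k ih, ih]
      linarith
  exact funext fun k => key k (h3 k)

end QuasiGreedy

/-! ### Dependence of the quasi-greedy expansion on the base -/

section Base

open Filter Topology

variable {q s : ℝ}

theorem qg_lt_qg (hq : 1 < q) (hqs : q < s) : LexLt (qg q) (qg s) := by
  have hs := hq.trans hqs
  have step : ∀ j, rem q j ≤ rem s j → q * rem q j < s * rem s j := fun j h => by
    have h1 := rem_mem hq j
    nlinarith
  have key : ∀ j, (∀ i < j, qg q i = qg s i) → rem q j ≤ rem s j := by
    intro j
    induction j with
    | zero => intro _; exact le_rfl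
    | succ j ih =>
      intro h
      have h1 := step j (ih fun i hi => h i (by omega))
      rw [rem_succ, rem_succ, h j (by omega)]
      linarith
  have hle : LexLe (qg q) (qg s) := by
    refine lexLe_of_forall fun m hm => ?_
    have h1 := step m (key m hm)
    have h2 := qg_lt hq m
    have h3 := le_qg_add_one hs m
    have h4 : (qg q m : ℝ) < qg s m + 1 := by linarith
    exact Nat.lt_succ_iff.1 (by exact_mod_cast h4)
  rcases hle with h | h
  · exact h
  exfalso
  have h1 : ∀ j : ℕ, (s - q) * q ^ j ≤ rem s (j + 1) - rem q (j + 1) := by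
    intro j
    induction j with
    | zero =>
      have e1 := rem_succ q 0
      have e2 := rem_succ s 0
      have e3 : rem q 0 = 1 := rfl
      have e4 : rem s 0 = 1 := rfl
      rw [e3] at e1
      rw [e4] at e2
      rw [e1, e2, h]
      linarith
    | succ j ih =>
      rw [rem_succ s, rem_succ q, h]
      have h2 := (rem_mem hs (j + 1)).1
      have h3 : 0 ≤ (s - q) * rem s (j + 1) := mul_nonneg (by linarith) h2.le
      have h4 : q * ((s - q) * q ^ j) ≤ q * (rem s (j + 1) - rem q (j + 1)) := by gcongr
      rw [pow_succ]
      linarith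
  obtain ⟨n, hn⟩ := pow_unbounded_of_one_lt (1 / (s - q)) hq
  have h2 := h1 n
  have h3 := (rem_mem hs (n + 1)).2
  have h4 := (rem_mem hq (n + 1)).1
  rw [div_lt_iff₀ (by linarith)] at hn
  linarith

theorem eventually_agree_left (hq : 1 < q) (N : ℕ) :
    ∀ᶠ s in 𝓝[<] q, ∀ i < N, qg s i = qg q i := by
  have hmem : ∀ᶠ s in 𝓝[<] q, 1 < s ∧ s < q :=
    (eventually_nhdsWithin_of_eventually_nhds (lt_mem_nhds hq)).and self_mem_nhdsWithin
  have hid : Tendsto (fun s : ℝ => s) (𝓝[<] q) (𝓝 q) :=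
    tendsto_nhdsWithin_of_tendsto_nhds tendsto_id
  have key : ∀ N : ℕ, (∀ᶠ s in 𝓝[<] q, (∀ i < N, qg s i = qg q i) ∧ rem s N ≤ rem q N) ∧
      Tendsto (fun s => rem s N) (𝓝[<] q) (𝓝 (rem q N)) := by
    intro N
    induction N with
    | zero => exact ⟨Eventually.of_forall fun s => ⟨fun i hi => absurd hi (Nat.not_lt_zero i),
        le_rfl⟩, tendsto_const_nhds⟩
    | succ N ih =>
      obtain ⟨h1, h2⟩ := ih
      have h3 : Tendsto (fun s => s * rem s N) (𝓝[<] q) (𝓝 (q * rem q N)) := hid.mul h2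
      have h4 := h3.eventually (lt_mem_nhds (qg_lt hq N))
      have h5 : ∀ᶠ s in 𝓝[<] q, (∀ i < N + 1, qg s i = qg q i) ∧ rem s (N + 1) ≤ rem q (N + 1) := by
        filter_upwards [hmem, h1, h4] with s hs h1 h4
        have h6 : s * rem s N ≤ q * rem q N :=
          mul_le_mul hs.2.le h1.2 (rem_mem hs.1 N).1.le (by linarith)
        have h7 : qg s N = qg q N :=
          eq_toNat_ceil_sub_one h4 (h6.trans (le_qg_add_one hq N))
        refine ⟨fun i hi => ?_, ?_⟩
        · rcases Nat.lt_succ_iff_lt_or_eq.1 hi with hi | rfl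
          · exact h1.1 i hi
          · exact h7
        · rw [rem_succ, rem_succ, h7]
          linarith
      refine ⟨h5, ?_⟩
      refine (h3.sub_const (qg q N : ℝ)).congr' ?_
      filter_upwards [h5] with s hs
      rw [rem_succ, hs.1 N (by omega)]
  exact (key N).1.mono fun s hs => hs.1

theorem tendsto_rem_right (hq : 1 < q) {N : ℕ} (h : ∀ j < N, rem q (j + 1) < 1) :
    (∀ᶠ s in 𝓝[>] q, ∀ i < N, qg s i = qg q i) ∧
      Tendsto (fun s => rem s N) (𝓝[>] q) (𝓝 (rem q N)) := by
  have hid : Tendsto (fun s : ℝ => s) (𝓝[>] q) (𝓝 q) :=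
    tendsto_nhdsWithin_of_tendsto_nhds tendsto_id
  induction N with
  | zero => exact ⟨Eventually.of_forall fun s i hi => absurd hi (Nat.not_lt_zero i),
      tendsto_const_nhds⟩
  | succ N ih =>
    obtain ⟨h1, h2⟩ := ih fun j hj => h j (by omega)
    have h3 : Tendsto (fun s => s * rem s N) (𝓝[>] q) (𝓝 (q * rem q N)) := hid.mul h2
    have h6 := h N (by omega)
    rw [rem_succ] at h6
    have h4 := h3.eventually (lt_mem_nhds (qg_lt hq N))
    have h5 := h3.eventually (gt_mem_nhds (show q * rem q N < qg q N + 1 by linarith))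
    have h7 : ∀ᶠ s in 𝓝[>] q, ∀ i < N + 1, qg s i = qg q i := by
      filter_upwards [h1, h4, h5] with s h1 h4 h5 i hi
      rcases Nat.lt_succ_iff_lt_or_eq.1 hi with hi | rfl
      · exact h1 i hi
      · exact eq_toNat_ceil_sub_one h4 h5.le
    refine ⟨h7, ?_⟩
    refine (h3.sub_const (qg q N : ℝ)).congr' ?_
    filter_upwards [h7] with s hs
    rw [rem_succ, hs N (by omega)]

theorem eventually_agree_right (hq : 1 < q) (h : ∀ j, rem q (j + 1) ≠ 1) (N : ℕ) :
    ∀ᶠ s in 𝓝[>] q, ∀ i < N, qg s i = qg q i :=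
  (tendsto_rem_right hq fun j _ => lt_of_le_of_ne (rem_mem hq (j + 1)).2 (h j)).1

/-- To the right of a base with periodic quasi-greedy expansion of `1`, the expansions start with
the period increased by one in its last digit, followed by a long block of zeros. -/
theorem eventually_right_of_periodic (hq : 1 < q) (h : ∃ p, rem q (p + 1) = 1) :
    ∃ p, rem q (p + 1) = 1 ∧ ∀ M, ∀ᶠ s in 𝓝[>] q, (∀ i < p, qg s i = qg q i) ∧
      qg s p = qg q p + 1 ∧ ∀ i < M, qg s (p + 1 + i) = 0 := by
  classical
  obtain ⟨p, hp⟩ : ∃ p, p = Nat.find h := ⟨_, rfl⟩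
  have hspec := Nat.find_spec h
  have hmin : ∀ j < p, rem q (j + 1) < 1 := fun j hj =>
    lt_of_le_of_ne (rem_mem hq (j + 1)).2 (Nat.find_min h (by omega))
  rw [← hp] at hspec
  refine ⟨p, hspec, fun M => ?_⟩
  have hid : Tendsto (fun s : ℝ => s) (𝓝[>] q) (𝓝 q) :=
    tendsto_nhdsWithin_of_tendsto_nhds tendsto_id
  obtain ⟨h1, h2⟩ := tendsto_rem_right hq hmin
  have h3 : Tendsto (fun s => s * rem s p) (𝓝[>] q) (𝓝 (q * rem q p)) := hid.mul h2
  have h4 : q * rem q p = qg q p + 1 := by rw [rem_succ] at hspec; linarith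
  have h5 := h3.eventually (gt_mem_nhds (show q * rem q p < qg q p + 2 by linarith))
  have h6 : ∀ᶠ s in 𝓝[>] q, qg s p = qg q p + 1 := by
    filter_upwards [h1, h5, self_mem_nhdsWithin] with s h1 h5 hs
    have hs : q < s := hs
    have h7 : ∀ j ≤ p, rem q j ≤ rem s j := by
      intro j
      induction j with
      | zero => intro _; exact le_rfl
      | succ j ih =>
        intro hj
        have := ih (by omega)
        have h8 := (rem_mem hq j).1
        rw [rem_succ, rem_succ, h1 j (by omega)]
        nlinarith
    have h8 := h7 p le_rfl
    have h9 := (rem_mem hq p).1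
    refine eq_toNat_ceil_sub_one ?_ ?_
    · push_cast; nlinarith
    · push_cast; linarith
  have h7 : ∀ i, Tendsto (fun s => rem s (p + 1 + i)) (𝓝[>] q) (𝓝 0) ∧
      ∀ᶠ s in 𝓝[>] q, ∀ j < i, qg s (p + 1 + j) = 0 := by
    intro i
    induction i with
    | zero =>
      refine ⟨?_, Eventually.of_forall fun s j hj => absurd hj (Nat.not_lt_zero j)⟩
      have h8 := h3.sub_const ((qg q p : ℝ) + 1)
      rw [h4, sub_self] at h8
      refine h8.congr' ?_
      filter_upwards [h6] with s hs
      rw [add_zero, rem_succ, hs]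
      push_cast
      ring
    | succ i ih =>
      obtain ⟨h8, h9⟩ := ih
      have h10 : Tendsto (fun s => s * rem s (p + 1 + i)) (𝓝[>] q) (𝓝 0) := by
        simpa using hid.mul h8
      have h11 := h10.eventually (gt_mem_nhds (zero_lt_one' ℝ))
      have h12 : ∀ᶠ s in 𝓝[>] q, qg s (p + 1 + i) = 0 := by
        filter_upwards [h11, self_mem_nhdsWithin] with s h11 hs
        have hs : 1 < s := hq.trans hs
        refine eq_toNat_ceil_sub_one ?_ ?_
        · have := (rem_mem hs (p + 1 + i)).1
          push_cast
          have : 0 < s := by linarith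
          positivity
        · push_cast; linarith
      refine ⟨h10.congr' ?_, ?_⟩
      · filter_upwards [h12] with s hs
        rw [← add_assoc, rem_succ, hs]
        simp
      · filter_upwards [h9, h12] with s h9 h12 j hj
        rcases Nat.lt_succ_iff_lt_or_eq.1 hj with hj | rfl
        · exact h9 j hj
        · exact h12
  filter_upwards [h1, h6, (h7 M).2] with s h1 h6 h7
  exact ⟨h1, h6, h7⟩

end Base

/-! ### The lexicographic characterization of univoque sequences -/

section Univoque

variable {q : ℝ} {c : ℕ → ℕ}

theorem mem_UqSeq_iff : c ∈ UqSeq q ↔ (∀ i, c i ≤ alphaOne q) ∧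
    ∀ c', (∀ i, c' i ≤ alphaOne q) → val q c' = val q c → c' = c := by
  constructor
  · rintro ⟨x, ⟨b, hb, huniq⟩, hc⟩
    refine ⟨hc.1, fun c' hc' hv => ?_⟩
    rw [huniq c hc]
    exact huniq c' ⟨hc', hc.2.trans hv.symm⟩
  · rintro ⟨hc, h⟩
    exact ⟨val q c, ⟨c, ⟨hc, rfl⟩, fun c' hc' => h c' hc'.1 hc'.2.symm⟩, hc, rfl⟩

theorem val_lt_one_of_adm (hq : 1 < q) (hc : ∀ i, c i ≤ alphaOne q)
    (h : Adm (alphaOne q) (qg q) c) {n : ℕ} (hn : c n < alphaOne q) :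
    val q (shift (n + 1) c) < 1 := by
  have hq0 : 0 < q := by linarith
  have h1 : ∀ n, c n < alphaOne q → ∃ m, (∀ i < m, shift (n + 1) c i = qg q i) ∧
      shift (n + 1) c m < qg q m ∧ c (n + 1 + m) < alphaOne q := fun n hn => by
    obtain ⟨m, h2, h3⟩ := h n hn
    exact ⟨m, h2, h3, h3.trans_le (qg_le hq m)⟩
  have h2 : ∀ n, c n < alphaOne q → val q (shift (n + 1) c) ≤ 1 := by
    intro n hn
    refine val_le_one_of_family hq (qg_le hq) (val_qg hq)
      (S := {x | ∃ n, c n < alphaOne q ∧ x = shift (n + 1) c}) ?_ ?_ _ ⟨n, hn, rfl⟩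
    · rintro _ ⟨n, -, rfl⟩ i
      exact hc _
    · rintro _ ⟨n, hn, rfl⟩
      obtain ⟨m, h3, h4, h5⟩ := h1 n hn
      exact Or.inr ⟨m, h3, h4, n + 1 + m, h5, by rw [shift_shift]; rfl⟩
  obtain ⟨m, h3, h4, h5⟩ := h1 n hn
  have h6 := val_sub_le hq (x := shift (n + 1) c) (fun i => hc _) (qg_le hq) h3 h4
  have h7 := h2 _ h5
  have h8 := val_shift_pos hq (qg_le hq) (infiniteSeq_qg hq) (m + 1)
  rw [shift_shift, val_qg hq] at h6
  have h9 : (val q (shift (n + 1 + (m + 1)) c) - 1 - val q (shift (m + 1) (qg q))) / q ^ (m + 1)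
      < 0 := by
    refine div_neg_of_neg_of_pos ?_ (by positivity)
    have : n + 1 + m + 1 = n + 1 + (m + 1) := by ring
    rw [this] at h7
    linarith
  linarith

theorem adm_of_unique (hq : 1 < q) (hc : ∀ i, c i ≤ alphaOne q)
    (h : ∀ c', (∀ i, c' i ≤ alphaOne q) → val q c' = val q c → c' = c) :
    Adm (alphaOne q) (qg q) c := by
  intro n hn
  by_contra hlt
  have hq0 : 0 < q := by linarith
  have h1 := one_le_val hq (x := shift (n + 1) c) (fun i => hc _) (not_lexLt.1 hlt)
  have h2 := val_le hq (c := shift (n + 1) c) (fun i => hc _)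
  obtain ⟨e, he, hev⟩ := exists_val_eq hq (sub_one_le_alphaOne hq)
    (x := val q (shift (n + 1) c) - 1) (by linarith) (by linarith)
  let c' : ℕ → ℕ := fun i => if i < n then c i else if i = n then c n + 1 else e (i - (n + 1))
  have hc' : ∀ i, c' i ≤ alphaOne q := by
    intro i
    have := hc i
    have := he (i - (n + 1))
    simp only [c']
    split_ifs <;> omega
  have hcn : c' n = c n + 1 := by simp [c']
  have hshift : shift (n + 1) c' = e := by
    funext i
    have h3 : ¬ n + 1 + i < n := by omega
    have h4 : ¬ n + 1 + i = n := by omega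
    simp only [shift_apply, c', if_neg h3, if_neg h4, Nat.add_sub_cancel_left]
  have hv : val q c' = val q c := by
    rw [val_split hq hc' (n + 1), val_split hq hc (n + 1), Finset.sum_range_succ,
      Finset.sum_range_succ, hshift, hev, hcn]
    have h5 : ∑ i ∈ Finset.range n, (c' i : ℝ) / q ^ (i + 1)
        = ∑ i ∈ Finset.range n, (c i : ℝ) / q ^ (i + 1) :=
      Finset.sum_congr rfl fun i hi => by
        simp only [c', if_pos (Finset.mem_range.1 hi)]
    rw [h5]
    push_cast
    ring
  have := congrFun (h c' hc' hv) n
  omega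

/-- The lexicographic characterization of univoque sequences. -/
theorem mem_UqSeq_iff_bounded (hq : 1 < q) : c ∈ UqSeq q ↔ Bounded (alphaOne q) (qg q) c := by
  have hq0 : 0 < q := by linarith
  rw [mem_UqSeq_iff]
  constructor
  · rintro ⟨hc, h⟩
    refine ⟨hc, adm_of_unique hq hc h, adm_of_unique hq (conj_le _ c) fun c' hc' hv => ?_⟩
    rw [← conj_conj hc']
    congr 1
    refine h _ (conj_le _ c') ?_
    rw [val_conj hq hc', hv, val_conj hq hc]
    ring
  · intro hb
    have key : ∀ c c' : ℕ → ℕ, (∀ i, c i ≤ alphaOne q) → (∀ i, c' i ≤ alphaOne q) →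
        Adm (alphaOne q) (qg q) c → val q c' = val q c → ¬ LexLt c c' := by
      rintro c c' hc hc' h hv ⟨n, h1, h2⟩
      have h3 := val_sub_le hq hc hc' h1 h2
      have h4 := val_lt_one_of_adm hq hc h (h2.trans_le (hc' n))
      have h5 := val_nonneg hq (shift (n + 1) c')
      rw [hv, sub_self] at h3
      have h6 : (val q (shift (n + 1) c) - 1 - val q (shift (n + 1) c')) / q ^ (n + 1) < 0 :=
        div_neg_of_neg_of_pos (by linarith) (by positivity)
      linarith
    refine ⟨hb.1, fun c' hc' hv => ?_⟩
    refine (not_lexLt.1 (key c c' hb.1 hc' hb.2.1 hv)).antisymm (not_lexLt.1 fun hlt => ?_)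
    refine key _ _ (conj_le _ c) (conj_le _ c') hb.2.2 ?_ (hlt.conj hb.1)
    rw [val_conj hq hc', val_conj hq hb.1, hv]

end Univoque

/-! ### Stability -/

section Stability

open Filter Topology

variable {q s : ℝ}

theorem mem_VSet_iff (hq : 1 < q) :
    q ∈ VSet ↔ ∀ k, LexLe (conj (alphaOne q) (shift k (qg q))) (qg q) := by
  have h : q ∈ VSet ↔ 1 < q ∧ ∀ k, LexLe (conj (alphaOne q) (shift (k + 1) (qg q))) (qg q) := by
    rw [← quasiGreedy_one hq]; rfl
  rw [h, and_iff_right hq]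
  refine ⟨fun h k => ?_, fun h k => h (k + 1)⟩
  cases k with
  | zero => rw [shift_zero]; exact (dominant_qg hq).conj_self_lt.le
  | succ k => exact h k

theorem bounded_const (hs : 1 < s) : Bounded (alphaOne s) (qg s) fun _ => alphaOne s := by
  refine ⟨fun _ => le_rfl, fun n hn => absurd hn (lt_irrefl _), fun n _ => ?_⟩
  refine ⟨0, fun i hi => absurd hi (Nat.not_lt_zero i), ?_⟩
  simp only [shift_apply, conj_apply, Nat.sub_self, qg_zero]
  exact alphaOne_pos hs

theorem alphaOne_eq_of_UqSeq_eq (hq : 1 < q) (hs : 1 < s) (h : UqSeq q = UqSeq s) :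
    alphaOne q = alphaOne s := by
  refine le_antisymm ?_ ?_
  · exact ((mem_UqSeq_iff_bounded hs).1 (h ▸ (mem_UqSeq_iff_bounded hq).2 (bounded_const hq))).1 0
  · exact ((mem_UqSeq_iff_bounded hq).1 (h ▸ (mem_UqSeq_iff_bounded hs).2 (bounded_const hs))).1 0

theorem UqSeq_eq_of_bounded (hq : 1 < q) (hs : 1 < s) (hA : alphaOne s = alphaOne q)
    (h : ∀ c, Bounded (alphaOne q) (qg q) c ↔ Bounded (alphaOne q) (qg s) c) :
    UqSeq q = UqSeq s := by
  ext c
  rw [mem_UqSeq_iff_bounded hq, mem_UqSeq_iff_bounded hs, hA, h]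

theorem UqSeq_ne_of_mem_VSet (hq : 1 < q) (hV : q ∈ VSet) (hqs : q < s) : UqSeq q ≠ UqSeq s := by
  intro h
  have hs := hq.trans hqs
  have hA := alphaOne_eq_of_UqSeq_eq hq hs h
  have hd := dominant_qg hq
  have h1 := bounded_consZero hd.le hd.shift_le (fun k => (mem_VSet_iff hq).1 hV (k + 1))
    (qg_lt_qg hq hqs)
  rw [hA, ← mem_UqSeq_iff_bounded hs, ← h, mem_UqSeq_iff_bounded hq] at h1
  exact not_bounded_consZero hd.pos (LexLe.refl _) h1

theorem not_stableFromAbove (hq : 1 < q) (hV : q ∈ VSet) : ¬ StableFromAbove q :=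
  fun ⟨_, hqs, h⟩ => UqSeq_ne_of_mem_VSet hq hV hqs h

/-- Every reflected tail of the quasi-greedy expansion of `1` is strictly smaller than the expansion
itself. -/
def StrictlyDominant (q : ℝ) : Prop := ∀ k, LexLt (conj (alphaOne q) (shift k (qg q))) (qg q)

theorem StrictlyDominant.mem_VSet (hq : 1 < q) (h : StrictlyDominant q) : q ∈ VSet :=
  (mem_VSet_iff hq).2 fun k => (h k).le

theorem exists_le_of_not_strictlyDominant (h : ¬ StrictlyDominant q) :
    ∃ k, LexLe (qg q) (conj (alphaOne q) (shift k (qg q))) := by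
  unfold StrictlyDominant at h
  push Not at h
  exact h.imp fun k hk => not_lexLt.1 hk

theorem eventually_lt_nhdsLT (hq : 1 < q) : ∀ᶠ s in 𝓝[<] q, 1 < s ∧ s < q :=
  (eventually_nhdsWithin_of_eventually_nhds (lt_mem_nhds hq)).and self_mem_nhdsWithin

theorem eventually_UqSeq_eq_left (hq : 1 < q) (h : ¬ StrictlyDominant q) :
    ∀ᶠ s in 𝓝[<] q, UqSeq s = UqSeq q := by
  have hd := dominant_qg hq
  obtain ⟨k, hk, hv⟩ := hd.exists_pos_of_le (exists_le_of_not_strictlyDominant h)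
  filter_upwards [eventually_lt_nhdsLT hq, eventually_agree_left hq (k + 1)] with s hs ha
  refine (UqSeq_eq_of_bounded hq hs.1 ?_ fun c => ⟨hd.bounded_of_agree hk hv ha,
    Bounded.mono (qg_lt_qg hs.1 hs.2).le⟩).symm
  rw [← qg_zero, ← qg_zero, ha 0 (by omega)]

theorem stableFromBelow (hq : 1 < q) (h : ¬ StrictlyDominant q) : StableFromBelow q := by
  obtain ⟨s, h1, h2⟩ := ((eventually_lt_nhdsLT hq).and (eventually_UqSeq_eq_left hq h)).exists
  exact ⟨s, h1.1, h1.2, h2⟩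

theorem StrictlyDominant.not_stableFromBelow (hq : 1 < q) (h : StrictlyDominant q) :
    ¬ StableFromBelow q := by
  rintro ⟨s, hs, hsq, hU⟩
  have hA := alphaOne_eq_of_UqSeq_eq hs hq hU
  have hα := dominant_qg hq
  obtain ⟨d, hd⟩ := exists_firstDiff h
  obtain ⟨m, h1, h2⟩ := qg_lt_qg hs hsq
  obtain ⟨N, hN, hgood⟩ := hd.exists_good hα (m + 2)
  have hlow := lowered_lowerPeriodic hα hd hgood
  have hb : Bounded (alphaOne q) (qg q) (consZero (lowerPeriodic (qg q) N)) :=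
    bounded_consZero (lowerPeriodic_le hα) (lowerPeriodic_shift_le hα hd (by omega) hgood)
      (fun k => hd.conj_shift_le_of_periodic hα (by omega) hgood hlow
        (shift_lowerPeriodic _ _) (k + 1)) (hlow.lexLt (by omega))
  rw [← mem_UqSeq_iff_bounded hq, ← hU, mem_UqSeq_iff_bounded hs] at hb
  refine not_bounded_consZero (alphaOne_pos hs) (LexLt.le ⟨m, fun i hi => ?_, ?_⟩) hb
  · rw [h1 i hi, hlow.eq i (by omega)]
  · rwa [hlow.eq m (by omega)]

theorem stableFromAbove (hq : 1 < q) (hV : q ∉ VSet) : StableFromAbove q := by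
  have hα := dominant_qg hq
  rw [mem_VSet_iff hq] at hV
  push Not at hV
  obtain ⟨k, hk, hv⟩ := hα.exists_pos_of_lt (hV.imp fun k hk => not_lexLe.1 hk)
  have hgt : ∀ᶠ s in 𝓝[>] q, q < s := self_mem_nhdsWithin
  by_cases hper : ∃ p, rem q (p + 1) = 1
  · obtain ⟨p, hp, hev⟩ := eventually_right_of_periodic hq hper
    have hshift := (shift_qg_eq_iff hq).2 hp
    have hp0 : 0 < p := by
      refine Nat.pos_of_ne_zero ?_
      rintro rfl
      have hc : ∀ i, qg q i = alphaOne q := by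
        intro i
        induction i with
        | zero => exact qg_zero q
        | succ i ih => rw [← ih]; nth_rw 2 [← hshift]; rw [shift_apply, add_comm, zero_add]
      obtain ⟨m, -, hm⟩ := hv
      rw [hc] at hm
      exact absurd hm (not_lt.2 (conj_le _ _ _))
    obtain ⟨s, hqs, h1, h2, h3⟩ := (hgt.and (hev (p + 2))).exists
    have hs := hq.trans hqs
    have hA : alphaOne s = alphaOne q := by rw [← qg_zero, ← qg_zero, h1 0 hp0]
    exact ⟨s, hqs, UqSeq_eq_of_bounded hq hs hA fun c => ⟨Bounded.mono (qg_lt_qg hq hqs).le,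
      bounded_of_period hk hv hshift (fun i => hA ▸ qg_le hs i) h1 h2 h3⟩⟩
  · obtain ⟨m, hm, hm'⟩ := hv
    obtain ⟨s, hqs, ha⟩ :=
      (hgt.and (eventually_agree_right hq (not_exists.1 hper) (k + m + 2))).exists
    have hA : alphaOne s = alphaOne q := by rw [← qg_zero, ← qg_zero, ha 0 (by omega)]
    exact ⟨s, hqs, UqSeq_eq_of_bounded hq (hq.trans hqs) hA fun c =>
      ⟨Bounded.mono (qg_lt_qg hq hqs).le, bounded_of_agree_long hk hm hm' ha⟩⟩

/-! ### The closure of the set of univoque bases -/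

theorem mem_USet_iff (hq : 1 < q) : q ∈ USet ↔ Bounded (alphaOne q) (qg q) (qg q) := by
  have hexp : IsExpansionOf q 1 (qg q) := ⟨qg_le hq, (val_qg hq).symm⟩
  rw [← mem_UqSeq_iff_bounded hq]
  constructor
  · rintro ⟨-, h⟩
    exact ⟨1, h, hexp⟩
  · rintro ⟨x, hx, hc⟩
    have : x = 1 := hc.2.trans (val_qg hq)
    exact ⟨hq, this ▸ hx⟩

theorem mem_USet_of_strict (hq : 1 < q) (h1 : ∀ k, LexLt (shift (k + 1) (qg q)) (qg q))
    (h2 : ∀ k, LexLt (conj (alphaOne q) (shift (k + 1) (qg q))) (qg q)) : q ∈ USet :=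
  (mem_USet_iff hq).2 ⟨qg_le hq, fun n _ => h1 n, fun n _ => h2 n⟩

theorem strictlyDominant_of_mem_USet (h : q ∈ USet) : StrictlyDominant q := by
  have hq := h.1
  by_contra hW
  have hα := dominant_qg hq
  obtain ⟨k, hk, hv⟩ := hα.exists_pos_of_le (exists_le_of_not_strictlyDominant hW)
  have hb := (mem_USet_iff hq).1 h
  refine LexLt.irrefl ((hb.2.2 k ?_).trans_le hv)
  have := hα.le k
  simp only [conj_apply]
  omega

theorem not_mem_USet_of_not_mem_VSet (h : q ∉ VSet) : q ∉ USet :=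
  fun hU => h ((strictlyDominant_of_mem_USet hU).mem_VSet hU.1)

theorem eventually_not_mem_USet_right (hq : 1 < q) (h : ¬ StrictlyDominant q) :
    ∀ᶠ s in 𝓝[>] q, s ∉ USet := by
  have hα := dominant_qg hq
  obtain ⟨k, hk, hv⟩ := hα.exists_pos_of_le (exists_le_of_not_strictlyDominant h)
  by_cases hper : ∃ p, rem q (p + 1) = 1
  · obtain ⟨p, -, hev⟩ := eventually_right_of_periodic hq hper
    filter_upwards [self_mem_nhdsWithin, hev (p + 2)] with s hqs hs
    have hs1 : 1 < s := hq.trans hqs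
    refine not_mem_USet_of_not_mem_VSet fun hV => ?_
    have h1 := ((mem_VSet_iff hs1).1 hV (p + 1)).eq_below_right (A := alphaOne s) (k := p + 2)
      (fun i hi => by rw [conj_apply, shift_apply, hs.2.2 i hi, Nat.sub_zero]) (qg_le hs1)
      (p + 1) (by omega)
    have h2 := hs.2.2 0 (by omega)
    rw [add_zero] at h2
    have := alphaOne_pos hs1
    omega
  · rcases hv with ⟨m, hm, hm'⟩ | heq
    · filter_upwards [self_mem_nhdsWithin,
        eventually_agree_right hq (not_exists.1 hper) (k + m + 2)] with s hqs ha
      have hs1 : 1 < s := hq.trans hqs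
      have hA : alphaOne s = alphaOne q := by rw [← qg_zero, ← qg_zero, ha 0 (by omega)]
      refine not_mem_USet_of_not_mem_VSet fun hV => ?_
      have h1 := (mem_VSet_iff hs1).1 hV (k + 1)
      refine LexLt.irrefl (LexLe.trans_lt h1 ⟨m, fun i hi => ?_, ?_⟩)
      · rw [ha i (by omega), hm i hi, conj_apply, conj_apply, shift_apply, shift_apply,
          ha _ (by omega), hA]
      · rw [ha m (by omega), conj_apply, shift_apply, ha _ (by omega), hA]
        exact hm'
    · refine absurd ⟨k + k + 1, ?_⟩ hper
      rw [← shift_qg_eq_iff hq]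
      have h1 : conj (alphaOne q) (qg q) = shift (k + 1) (qg q) := by
        conv_lhs => rw [heq]
        exact conj_conj fun i => qg_le hq _
      rw [show k + k + 1 + 1 = k + 1 + (k + 1) by ring, ← shift_shift, ← h1, ← conj_shift, ← heq]

theorem strictlyDominant_of_mem_closure (hq : 1 < q) (h : q ∈ closure USet) :
    StrictlyDominant q := by
  by_contra hW
  rw [mem_closure_iff_frequently] at h
  refine h ?_
  rw [← nhdsNE_sup_pure, ← nhdsLT_sup_nhdsGT]
  refine eventually_sup.2 ⟨eventually_sup.2 ⟨?_, eventually_not_mem_USet_right hq hW⟩, ?_⟩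
  · filter_upwards [eventually_lt_nhdsLT hq, eventually_UqSeq_eq_left hq hW] with s hs hU
    exact not_mem_USet_of_not_mem_VSet fun hV => UqSeq_ne_of_mem_VSet hs.1 hV hs.2 hU
  · exact eventually_pure.2 fun hU => hW (strictlyDominant_of_mem_USet hU)

theorem continuousOn_val {A : ℕ} {c : ℕ → ℕ} (hc : ∀ i, c i ≤ A) (hs : 1 < s) :
    ContinuousOn (fun t => val t c) (Set.Icc s q) := by
  unfold val
  refine continuousOn_tsum (u := fun i => (A : ℝ) / s ^ (i + 1)) (fun i => ?_)
    (hasSum_const hs A).summable fun i t ht => ?_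
  · refine continuousOn_const.div (by fun_prop) fun t ht => ?_
    have : 0 < t := by linarith [ht.1]
    positivity
  · have ht0 : s ≤ t := ht.1
    have h0 : 0 < s := by linarith
    have h1 : 0 < t := by linarith
    rw [Real.norm_of_nonneg (by positivity)]
    have := hc i
    gcongr

theorem FirstDiff.exists_bound {A : ℕ} {α d : ℕ → ℕ} (hd : FirstDiff A α d) {p : ℕ}
    (hp : shift (p + 1) α = α) : ∃ L, ∀ k, d k < L := by
  have h1 : ∀ t k, d (k + (p + 1) * t) = d k := by
    intro t k
    have h2 : ∀ j, α (k + (p + 1) * t + j) = α (k + j) := by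
      intro j
      induction t with
      | zero => simp
      | succ t ih =>
        rw [← ih]
        conv_rhs => rw [← hp]
        rw [shift_apply]
        congr 1
        ring
    refine hd.eq_of (fun j hj => ?_) ?_
    · rw [h2]; exact (hd k).1 j hj
    · rw [h2]; exact (hd k).2
  refine ⟨((Finset.range (p + 1)).sup d) + 1, fun k => ?_⟩
  rw [← Nat.mod_add_div k (p + 1), h1]
  exact Nat.lt_succ_of_le (Finset.le_sup (Finset.mem_range.2 (Nat.mod_lt _ (by omega))))

/-- A strictly dominant sequence lying between the expansions of `1` in two bases is the expansion
of `1` in an intermediate univoque base. -/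
theorem exists_mem_USet_of_between {a : ℕ → ℕ} (hs : 1 < s) (hsq : s ≤ q)
    (ha : ∀ i, a i ≤ alphaOne q) (ha0 : a 0 = alphaOne q)
    (hsa : LexLe (qg s) a) (haq : LexLt a (qg q)) (h1 : ∀ k, LexLt (shift (k + 1) a) a)
    (h2 : ∀ k, LexLt (conj (alphaOne q) (shift (k + 1) a)) a) : ∃ r ∈ Set.Icc s q, r ∈ USet := by
  have hq := hs.trans_le hsq
  have h1' : ∀ k, LexLe (shift k a) a := fun k => by
    cases k with
    | zero => rw [shift_zero]; exact LexLe.refl _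
    | succ k => exact (h1 k).le
  have hq1 : val q a ≤ 1 := by
    refine val_le_one_of_family hq (qg_le hq) (val_qg hq) (S := Set.range fun k => shift k a)
      ?_ ?_ _ ⟨0, shift_zero a⟩
    · rintro _ ⟨k, rfl⟩ i
      exact ha _
    · rintro _ ⟨k, rfl⟩
      obtain ⟨m, h3, h4⟩ := (h1' k).trans_lt haq
      exact Or.inr ⟨m, h3, h4, k + (m + 1), (shift_shift _ _ _).symm⟩
  obtain ⟨r, hr, hr1⟩ := intermediate_value_Icc' hsq (continuousOn_val ha hs)
    ⟨hq1, one_le_val hs ha hsa⟩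
  have hr0 : 1 < r := hs.trans_le hr.1
  have hinf : InfiniteSeq a := by
    refine infiniteSeq_iff.2 fun k => ?_
    by_contra! hz
    refine LexLt.irrefl ((h2 k).trans_le (not_lexLt.1 ?_))
    rintro ⟨m, -, hm⟩
    have := hz (1 + m)
    have h3 := ha m
    rw [conj_apply, shift_apply, add_assoc, this] at hm
    omega
  have hqg := qg_eq_of_dominant hr0 ha hinf hr1 h1'
  have hA : alphaOne r = alphaOne q := by rw [← qg_zero r, hqg, ha0]
  refine ⟨r, hr, mem_USet_of_strict hr0 ?_ ?_⟩
  · rw [hqg]; exact h1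
  · rw [hqg, hA]; exact h2

theorem StrictlyDominant.mem_closure (hq : 1 < q) (h : StrictlyDominant q) :
    q ∈ closure USet := by
  have hα := dominant_qg hq
  by_cases hper : ∃ p, rem q (p + 1) = 1
  · obtain ⟨p, hp⟩ := hper
    obtain ⟨d, hd⟩ := exists_firstDiff h
    obtain ⟨L, hL⟩ := hd.exists_bound ((shift_qg_eq_iff hq).2 hp)
    rw [Metric.mem_closure_iff]
    intro ε hε
    obtain ⟨s, hs1, hs2⟩ := exists_between (max_lt hq (sub_lt_self q hε))
    have hs := (le_max_left _ _).trans_lt hs1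
    have hsε := (le_max_right _ _).trans_lt hs1
    obtain ⟨m, h1, h2⟩ := qg_lt_qg hs hs2
    obtain ⟨a, ha, hA, haq, ha1, ha2⟩ := exists_strict_approx hα hd hL (m + 1)
    obtain ⟨r, hr, hrU⟩ := exists_mem_USet_of_between hs hs2.le hA
      ((ha 0 (by omega)).trans (qg_zero q))
      (LexLt.le ⟨m, fun i hi => by rw [h1 i hi, ha i (by omega)], by rwa [ha m (by omega)]⟩)
      haq ha1 ha2
    refine ⟨r, hrU, ?_⟩
    rw [Real.dist_eq, abs_of_nonneg (by linarith [hr.2])]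
    linarith [hr.1]
  · refine subset_closure (mem_USet_of_strict hq (fun k => ?_) fun k => h (k + 1))
    refine (hα.shift_le (k + 1)).resolve_right fun he => hper ⟨k, (shift_qg_eq_iff hq).1 he⟩

end Stability

end Univoque

/-- stability trichotomy. -/
theorem stability_trichotomy (q : ℝ) (hq : 1 < q) :
    (q ∈ closure USet → ¬ StableFromBelow q ∧ ¬ StableFromAbove q) ∧
    (q ∈ VSet \ closure USet → StableFromBelow q ∧ ¬ StableFromAbove q) ∧
    (q ∉ VSet → StableFromBelow q ∧ StableFromAbove q) := by
  refine ⟨fun h => ?_, fun h => ?_, fun h => ?_⟩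
  · have hW := Univoque.strictlyDominant_of_mem_closure hq h
    exact ⟨hW.not_stableFromBelow hq, Univoque.not_stableFromAbove hq (hW.mem_VSet hq)⟩
  · exact ⟨Univoque.stableFromBelow hq fun hW => h.2 (hW.mem_closure hq),
      Univoque.not_stableFromAbove hq h.1⟩
  · exact ⟨Univoque.stableFromBelow hq fun hW => h (hW.mem_VSet hq),
      Univoque.stableFromAbove hq h⟩
end
end

section
/- Let q > 1 be a real number and α₁ = ⌈q⌉ − 1. The following four statements are equivalent: (i) q does not belong to the closure of U; (ii) U_q' is a subshift of finite type over the alphabet {0, …, α₁}; (iii) U_q' is a subshift over the alphabet {0, …, α₁}; (iv) U_q' is a closed subset of {0, …, α₁}^ℕ in the product (coordinate-wise convergence) topology, where the alphabet carries the discrete topology. -/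
open Classical

noncomputable section

/-- `S` is a subshift over the alphabet `{0, …, m}`: some set `F` of forbidden words
determines membership of sequences with digits `≤ m` by exclusion of all blocks. -/
def IsSubshift (m : ℕ) (S : Set (ℕ → ℕ)) : Prop :=
  ∃ F : Set (List ℕ),
    ∀ c : ℕ → ℕ, (∀ i, c i ≤ m) →
      (c ∈ S ↔ ∀ i n : ℕ, 0 < n → (List.ofFn fun j : Fin n => c (i + j)) ∉ F)

/-- `S` is a subshift of finite type over `{0, …, m}`. -/
def IsSubshiftOfFiniteType (m : ℕ) (S : Set (ℕ → ℕ)) : Prop :=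
  ∃ F : Set (List ℕ), F.Finite ∧
    ∀ c : ℕ → ℕ, (∀ i, c i ≤ m) →
      (c ∈ S ↔ ∀ i n : ℕ, 0 < n → (List.ofFn fun j : Fin n => c (i + j)) ∉ F)

/-- The value `∑ c_i q^{-(i+1)}` of the digit sequence `c` in base `q`. -/
def digitVal (q : ℝ) (c : ℕ → ℕ) : ℝ := ∑' i, (c i : ℝ) / q ^ (i + 1)

/-- The sequence obtained from `c` by deleting its first `n` terms. -/
def shiftSeq (n : ℕ) (c : ℕ → ℕ) : ℕ → ℕ := fun i => c (n + i)

/-- The digitwise reflection `m - c_i` of `c`. -/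
def reflectSeq (m : ℕ) (c : ℕ → ℕ) : ℕ → ℕ := fun i => m - c i

lemma shiftSeq_zero (c : ℕ → ℕ) : shiftSeq 0 c = c := by
  funext i; simp [shiftSeq]

lemma shiftSeq_shiftSeq (n k : ℕ) (c : ℕ → ℕ) :
    shiftSeq k (shiftSeq n c) = shiftSeq (n + k) c := by
  funext i; simp [shiftSeq, add_assoc]

lemma reflectSeq_le (m : ℕ) (c : ℕ → ℕ) (i : ℕ) : reflectSeq m c i ≤ m := Nat.sub_le _ _

lemma reflectSeq_reflectSeq {m : ℕ} {c : ℕ → ℕ} (hc : ∀ i, c i ≤ m) :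
    reflectSeq m (reflectSeq m c) = c := by
  funext i; have := hc i; simp only [reflectSeq]; omega

/-! ### The lexicographic order -/

lemma lexLt_irrefl (a : ℕ → ℕ) : ¬ LexLt a a := by
  rintro ⟨n, -, h⟩; exact lt_irrefl _ h

lemma lexLt_trichotomy (a b : ℕ → ℕ) : LexLt a b ∨ a = b ∨ LexLt b a := by
  by_cases h : ∃ n, a n ≠ b n
  · have hlt : ∀ j < Nat.find h, a j = b j := fun j hj => not_not.1 (Nat.find_min h hj)
    rcases lt_or_gt_of_ne (Nat.find_spec h) with h1 | h1
    · exact Or.inl ⟨_, hlt, h1⟩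
    · exact Or.inr (Or.inr ⟨_, fun j hj => (hlt j hj).symm, h1⟩)
  · push Not at h
    exact Or.inr (Or.inl (funext h))

lemma LexLt.trans {a b c : ℕ → ℕ} (hab : LexLt a b) (hbc : LexLt b c) : LexLt a c := by
  obtain ⟨n, hn, hn'⟩ := hab
  obtain ⟨k, hk, hk'⟩ := hbc
  rcases lt_trichotomy n k with h | h | h
  · exact ⟨n, fun i hi => (hn i hi).trans (hk i (hi.trans h)), hk n h ▸ hn'⟩
  · subst h
    exact ⟨n, fun i hi => (hn i hi).trans (hk i hi), hn'.trans hk'⟩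
  · exact ⟨k, fun i hi => (hn i (hi.trans h)).trans (hk i hi), (hn k h).symm ▸ hk'⟩

lemma LexLt.reflectSeq {m : ℕ} {a b : ℕ → ℕ} (hb : ∀ i, b i ≤ m) (h : LexLt a b) :
    LexLt (reflectSeq m b) (reflectSeq m a) := by
  obtain ⟨n, hn, hn'⟩ := h
  refine ⟨n, fun i hi => ?_, ?_⟩
  · simp only [_root_.reflectSeq, hn i hi]
  · have := hb n
    simp only [_root_.reflectSeq]; omega

/-! ### Values of digit sequences -/

section Values

variable {q : ℝ} {m : ℕ} {a b c d : ℕ → ℕ}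

lemma summable_geometric_digits (hq : 1 < q) (M : ℝ) : Summable fun i : ℕ => M / q ^ (i + 1) := by
  have h : Summable fun i : ℕ => (M / q) * (q⁻¹) ^ i :=
    (summable_geometric_of_lt_one (by positivity) (inv_lt_one_of_one_lt₀ hq)).mul_left _
  refine h.congr fun i => ?_
  rw [pow_succ, inv_pow]
  field_simp

lemma digit_div_le (hq : 1 < q) (hc : ∀ i, c i ≤ m) (i : ℕ) :
    (c i : ℝ) / q ^ (i + 1) ≤ (m : ℝ) / q ^ (i + 1) := by
  have : (c i : ℝ) ≤ m := by exact_mod_cast hc i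
  gcongr

lemma summable_digits (hq : 1 < q) (hc : ∀ i, c i ≤ m) :
    Summable fun i => (c i : ℝ) / q ^ (i + 1) :=
  Summable.of_nonneg_of_le (fun i => by positivity) (digit_div_le hq hc)
    (summable_geometric_digits hq m)

lemma digitVal_const (hq : 1 < q) (m : ℕ) : digitVal q (fun _ => m) = m / (q - 1) := by
  have h0 : q ≠ 0 := by positivity
  have h1 : q - 1 ≠ 0 := by linarith
  have : ∀ i : ℕ, (m : ℝ) / q ^ (i + 1) = (m / q) * (q⁻¹) ^ i := fun i => by
    rw [pow_succ, inv_pow]; field_simp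
  simp only [digitVal, this]
  rw [tsum_mul_left, tsum_geometric_of_lt_one (by positivity) (inv_lt_one_of_one_lt₀ hq)]
  field_simp

lemma digitVal_nonneg (hq : 1 < q) (c : ℕ → ℕ) : 0 ≤ digitVal q c :=
  tsum_nonneg fun i => by positivity

lemma digitVal_le (hq : 1 < q) (hc : ∀ i, c i ≤ m) : digitVal q c ≤ m / (q - 1) := by
  rw [← digitVal_const hq]
  exact (summable_digits hq hc).tsum_le_tsum (digit_div_le hq hc) (summable_geometric_digits hq m)

lemma digitVal_pos (hq : 1 < q) (hc : ∀ i, c i ≤ m) {i : ℕ} (hi : c i ≠ 0) :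
    0 < digitVal q c := by
  refine (summable_digits hq hc).tsum_pos (fun i => by positivity) i ?_
  have : 0 < c i := Nat.pos_of_ne_zero hi
  positivity

lemma digitVal_reflectSeq (hq : 1 < q) (hc : ∀ i, c i ≤ m) :
    digitVal q (reflectSeq m c) = m / (q - 1) - digitVal q c := by
  rw [← digitVal_const hq, digitVal, digitVal, digitVal,
    ← (summable_geometric_digits hq m).tsum_sub (summable_digits hq hc)]
  refine tsum_congr fun i => ?_
  simp only [reflectSeq]
  rw [Nat.cast_sub (hc i), sub_div]

lemma digitVal_split (hq : 1 < q) (hc : ∀ i, c i ≤ m) (n : ℕ) :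
    digitVal q c = ∑ i ∈ Finset.range n, (c i : ℝ) / q ^ (i + 1)
      + digitVal q (shiftSeq n c) / q ^ n := by
  rw [digitVal, ← (summable_digits hq hc).sum_add_tsum_nat_add n]
  congr 1
  rw [digitVal, ← tsum_div_const]
  refine tsum_congr fun i => ?_
  simp only [shiftSeq]
  rw [add_comm n i, div_div, ← pow_add]
  ring_nf

lemma digitVal_sub_of_agree (hq : 1 < q) (ha : ∀ i, a i ≤ m) (hb : ∀ i, b i ≤ m) {i : ℕ}
    (h : ∀ j < i, a j = b j) :
    digitVal q a - digitVal q b = ((a i : ℝ) - b i + digitVal q (shiftSeq (i + 1) a)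
      - digitVal q (shiftSeq (i + 1) b)) / q ^ (i + 1) := by
  rw [digitVal_split hq ha (i + 1), digitVal_split hq hb (i + 1), Finset.sum_range_succ,
    Finset.sum_range_succ, Finset.sum_congr rfl fun j hj => by rw [h j (Finset.mem_range.1 hj)]]
  ring

lemma digitVal_eq_of_remainders (hq : 1 < q) {r : ℕ → ℝ} {B : ℝ} (hc : ∀ i, c i ≤ m)
    (hB : ∀ n, |r n| ≤ B) (hr : ∀ n, r (n + 1) = q * r n - c n) : digitVal q c = r 0 := by
  have h0 : q ≠ 0 := by positivity
  have hsum : ∀ n, ∑ i ∈ Finset.range n, (c i : ℝ) / q ^ (i + 1) = r 0 - r n / q ^ n := by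
    intro n
    induction n with
    | zero => simp
    | succ n ih =>
      rw [Finset.sum_range_succ, ih, hr n]
      field_simp
      ring
  have hlim : Filter.Tendsto (fun n => r n / q ^ n) Filter.atTop (nhds 0) := by
    have hg : Filter.Tendsto (fun n : ℕ => B * (q⁻¹) ^ n) Filter.atTop (nhds 0) := by
      simpa using (tendsto_pow_atTop_nhds_zero_of_lt_one (by positivity)
        (inv_lt_one_of_one_lt₀ hq)).const_mul B
    refine squeeze_zero_norm (fun n => ?_) hg
    rw [norm_div, Real.norm_eq_abs, norm_pow, Real.norm_eq_abs, abs_of_pos (by positivity : 0 < q),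
      inv_pow, ← div_eq_mul_inv]
    gcongr
    exact hB n
  have h1 := (summable_digits hq hc).hasSum.tendsto_sum_nat
  have h2 : Filter.Tendsto (fun n => r 0 - r n / q ^ n) Filter.atTop (nhds (r 0)) := by
    simpa using hlim.const_sub (r 0)
  simp only [hsum] at h1
  exact tendsto_nhds_unique h1 h2

lemma exists_digits_of_mem (hq : 1 < q) (hm : q ≤ m + 1) {x : ℝ} (h0 : 0 ≤ x)
    (hx : x ≤ m / (q - 1)) : ∃ c : ℕ → ℕ, (∀ i, c i ≤ m) ∧ digitVal q c = x := by
  have hq1 : 0 < q - 1 := by linarith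
  let D : ℝ → ℕ := fun y => min m ⌊q * y⌋₊
  let r : ℕ → ℝ := fun n => (fun y => q * y - D y)^[n] x
  have hr : ∀ n, r (n + 1) = q * r n - D (r n) := fun n => by
    simp only [r, Function.iterate_succ_apply']
  have hI : ∀ n, 0 ≤ r n ∧ r n ≤ m / (q - 1) := by
    intro n
    induction n with
    | zero => exact ⟨h0, hx⟩
    | succ n ih =>
      rw [hr n]
      obtain ⟨h1, h2⟩ := ih
      have hf : (⌊q * r n⌋₊ : ℝ) ≤ q * r n := Nat.floor_le (by positivity)
      rcases le_total m ⌊q * r n⌋₊ with h | h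
      · have hD : D (r n) = m := min_eq_left h
        have h' : (m : ℝ) ≤ ⌊q * r n⌋₊ := by exact_mod_cast h
        rw [hD]
        refine ⟨by linarith, ?_⟩
        rw [le_div_iff₀ hq1] at h2 ⊢
        nlinarith
      · have hD : D (r n) = ⌊q * r n⌋₊ := min_eq_right h
        rw [hD]
        have h3 := Nat.lt_floor_add_one (q * r n)
        have h4 : (1 : ℝ) ≤ m / (q - 1) := by rw [le_div_iff₀ hq1]; linarith
        exact ⟨by linarith, by linarith⟩
  refine ⟨fun n => D (r n), fun i => min_le_left _ _, ?_⟩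
  exact digitVal_eq_of_remainders (r := r) (B := m / (q - 1)) hq (fun i => min_le_left _ _)
    (fun n => by rw [abs_of_nonneg (hI n).1]; exact (hI n).2) hr

lemma tendsto_digitVal {ι : Type*} {l : Filter ι} {p : ι → ℝ} {e : ι → ℕ → ℕ} (hq : 1 < q)
    (hp : Filter.Tendsto p l (nhds q)) (he : ∀ᶠ x in l, ∀ i, e x i ≤ m)
    (hec : ∀ i, ∀ᶠ x in l, e x i = c i) :
    Filter.Tendsto (fun x => digitVal (p x) (e x)) l (nhds (digitVal q c)) := by
  obtain ⟨s, hs1, hsq⟩ := exists_between hq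
  refine tendsto_tsum_of_dominated_convergence (summable_geometric_digits hs1 m) (fun i => ?_) ?_
  · have hcast : Filter.Tendsto (fun x => (e x i : ℝ)) l (nhds (c i)) :=
      tendsto_const_nhds.congr' ((hec i).mono fun x hx => congrArg _ hx.symm)
    exact hcast.div (hp.pow _) (by positivity)
  · filter_upwards [he, hp.eventually (lt_mem_nhds hsq)] with x hx hsx i
    have h0 : 0 < p x := by linarith
    have hxi : (e x i : ℝ) ≤ m := by exact_mod_cast hx i
    rw [Real.norm_of_nonneg (by positivity)]
    gcongr

lemma digitVal_le_one_of_lexLe_tails (hq : 1 < q) (ha : ∀ i, a i ≤ m) (hc : ∀ i, c i ≤ m)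
    (ha1 : digitVal q a = 1) (P : ℕ → Prop)
    (hP : ∀ n, P n → shiftSeq n c = a ∨
      ∃ i, (∀ j < i, c (n + j) = a j) ∧ c (n + i) < a i ∧ P (n + i + 1))
    {n : ℕ} (hn : P n) : digitVal q (shiftSeq n c) ≤ 1 := by
  have hq1 : 0 < q - 1 := by linarith
  have key : ∀ r n, P n → digitVal q (shiftSeq n c) - 1 ≤ (m / (q - 1)) / q ^ r := by
    intro r
    induction r with
    | zero =>
      intro n _
      have := digitVal_le (m := m) (c := shiftSeq n c) hq fun i => hc _
      simp only [pow_zero, div_one]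
      linarith
    | succ r ih =>
      intro n hn
      rcases hP n hn with h | ⟨i, hi, hlt, hPi⟩
      · rw [h, ha1, sub_self]; positivity
      · have hd := digitVal_sub_of_agree (a := shiftSeq n c) (i := i) hq (fun i => hc _) ha hi
        rw [ha1, shiftSeq_shiftSeq] at hd
        rw [hd]
        have h1 := ih _ hPi
        have h2 := digitVal_nonneg hq (shiftSeq (i + 1) a)
        have h3 : ((shiftSeq n c i : ℕ) : ℝ) + 1 ≤ a i := by exact_mod_cast hlt
        calc _ ≤ ((m / (q - 1)) / q ^ r) / q ^ (i + 1) := by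
              gcongr
              rw [← add_assoc]
              linarith
          _ ≤ ((m / (q - 1)) / q ^ r) / q ^ 1 := by
              gcongr
              · exact hq.le
              · omega
          _ = _ := by rw [div_div, ← pow_add]
  have hlim : Filter.Tendsto (fun r : ℕ => (m / (q - 1) : ℝ) / q ^ r) Filter.atTop (nhds 0) :=
    tendsto_const_nhds.div_atTop (tendsto_pow_atTop_atTop_of_one_lt hq)
  have := ge_of_tendsto' hlim fun r => key r n hn
  linarith

end Values

/-! ### The quasi-greedy expansion of `1` -/

/-- `a` is the quasi-greedy expansion of `1` in base `q` over `{0, …, m}`: all its tails have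
values in `(0, 1]`. -/
structure IsQuasiGreedyUnit (q : ℝ) (m : ℕ) (a : ℕ → ℕ) : Prop where
  le : ∀ i, a i ≤ m
  val : digitVal q a = 1
  pos : ∀ n, 0 < digitVal q (shiftSeq n a)
  le_one : ∀ n, digitVal q (shiftSeq n a) ≤ 1

/-- No tail of `a` is lexicographically larger than `a`. -/
def IsShiftMaximal (a : ℕ → ℕ) : Prop := ∀ k, ¬ LexLt a (shiftSeq k a)

/-- The reflection of every tail of `a` is lexicographically smaller than `a`. -/
def IsReflectDominated (m : ℕ) (a : ℕ → ℕ) : Prop :=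
  ∀ k, LexLt (reflectSeq m (shiftSeq k a)) a

/-- `c` is a sequence over `{0, …, m}` with no competitor of the same value in base `q`. -/
def IsUnivoque (q : ℝ) (m : ℕ) (c : ℕ → ℕ) : Prop :=
  (∀ i, c i ≤ m) ∧ ∀ d : ℕ → ℕ, (∀ i, d i ≤ m) → digitVal q d = digitVal q c → d = c

section Univoque

variable {q : ℝ} {m : ℕ} {a b c d : ℕ → ℕ}

lemma mem_UqSeq_iff : c ∈ UqSeq q ↔ IsUnivoque q (alphaOne q) c := by
  constructor
  · rintro ⟨x, ⟨e, -, he⟩, hx⟩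
    refine ⟨hx.1, fun d hd hdc => ?_⟩
    rw [he c hx, he d ⟨hd, hx.2.trans hdc.symm⟩]
  · rintro ⟨hc, h⟩
    exact ⟨digitVal q c, ⟨c, ⟨hc, rfl⟩, fun d hd => h d hd.1 hd.2.symm⟩, hc, rfl⟩

lemma mem_USet_iff :
    q ∈ USet ↔ 1 < q ∧ ∃ c, digitVal q c = 1 ∧ IsUnivoque q (alphaOne q) c := by
  refine and_congr_right fun _ => ⟨?_, ?_⟩
  · rintro ⟨c, hc, h⟩
    exact ⟨c, hc.2.symm, hc.1, fun d hd hdc => h d ⟨hd, hc.2.trans hdc.symm⟩⟩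
  · rintro ⟨c, h1, hc, h⟩
    exact ⟨c, ⟨hc, h1.symm⟩, fun d hd => h d hd.1 (hd.2.symm.trans h1.symm)⟩

lemma alphaOne_eq_iff (hq : 1 < q) : alphaOne q = m ↔ (m : ℝ) < q ∧ q ≤ m + 1 := by
  have h1 : 1 < ⌈q⌉ := Int.lt_ceil.2 (by exact_mod_cast hq)
  have h2 : alphaOne q = m ↔ ⌈q⌉ = (m : ℤ) + 1 := by
    simp only [alphaOne]; omega
  rw [h2, Int.ceil_eq_iff]
  push_cast
  simp

lemma exists_isQuasiGreedyUnit (hq : 1 < q) (hm' : q ≤ m + 1) :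
    ∃ a, IsQuasiGreedyUnit q m a := by
  let D : ℝ → ℕ := fun y => ⌈q * y⌉₊ - 1
  let r : ℕ → ℝ := fun n => (fun y => q * y - D y)^[n] 1
  have hr : ∀ n, r (n + 1) = q * r n - D (r n) := fun n => by
    simp only [r, Function.iterate_succ_apply']
  have hD : ∀ y, 0 < y → (D y : ℝ) + 1 = ⌈q * y⌉₊ := fun y hy => by
    have : 0 < ⌈q * y⌉₊ := Nat.ceil_pos.2 (by positivity)
    simp only [D]
    rw [Nat.cast_sub (by omega)]
    push_cast; ring
  have hI : ∀ n, 0 < r n ∧ r n ≤ 1 := by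
    intro n
    induction n with
    | zero => exact ⟨one_pos, le_rfl⟩
    | succ n ih =>
      rw [hr n]
      have h1 := Nat.ceil_lt_add_one (by have := ih.1; positivity : 0 ≤ q * r n)
      have h2 := Nat.le_ceil (q * r n)
      have h3 := hD _ ih.1
      exact ⟨by linarith, by linarith⟩
  have hle : ∀ i, D (r i) ≤ m := fun i => by
    have h1 : ⌈q * r i⌉₊ ≤ m + 1 := Nat.ceil_le.2 (by
      push_cast
      have := hI i
      nlinarith)
    simp only [D]; omega
  have hval : ∀ n, digitVal q (shiftSeq n fun i => D (r i)) = r n := fun n =>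
    digitVal_eq_of_remainders (r := fun i => r (n + i)) (B := 1) hq (fun i => hle _)
      (fun k => by rw [abs_of_pos (hI _).1]; exact (hI _).2) fun k => hr _
  refine ⟨fun i => D (r i), hle, ?_, fun n => ?_, fun n => ?_⟩
  · have := hval 0
    rwa [shiftSeq_zero] at this
  · rw [hval]; exact (hI n).1
  · rw [hval]; exact (hI n).2

lemma IsQuasiGreedyUnit.head_eq (h : IsQuasiGreedyUnit q m a) (hq : 1 < q) (hm : (m : ℝ) < q) :
    a 0 = m := by
  have h1 := digitVal_split hq h.le 1
  rw [h.val] at h1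
  simp only [Finset.sum_range_one, zero_add, pow_one] at h1
  have h0 : 0 < q := by positivity
  field_simp at h1
  have h2 := h.pos 1
  have h3 := h.le_one 1
  have h4 : (m : ℝ) < a 0 + 1 := by linarith
  have h5 : m < a 0 + 1 := by exact_mod_cast h4
  have := h.le 0
  omega

lemma IsQuasiGreedyUnit.one_le_digitVal (h : IsQuasiGreedyUnit q m a) (hq : 1 < q)
    (hc : ∀ i, c i ≤ m) (hac : ¬ LexLt c a) : 1 ≤ digitVal q c := by
  rcases lexLt_trichotomy c a with h1 | h1 | ⟨i, hi, hlt⟩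
  · exact absurd h1 hac
  · rw [h1, h.val]
  · have h2 := digitVal_sub_of_agree hq hc h.le fun j hj => (hi j hj).symm
    have h3 := h.le_one (i + 1)
    have h4 := digitVal_nonneg hq (shiftSeq (i + 1) c)
    have h5 : (a i : ℝ) + 1 ≤ c i := by exact_mod_cast hlt
    have h6 : 0 ≤ digitVal q c - digitVal q a := by
      rw [h2]
      apply div_nonneg (by linarith) (by positivity)
    rw [h.val] at h6
    linarith

lemma IsQuasiGreedyUnit.isShiftMaximal (h : IsQuasiGreedyUnit q m a) (hq : 1 < q) :
    IsShiftMaximal a := by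
  rintro k ⟨i, hi, hlt⟩
  have h2 := digitVal_sub_of_agree (b := shiftSeq k a) hq h.le (fun i => h.le _) hi
  have h3 := h.le_one (i + 1)
  have h4 := h.pos (k + (i + 1))
  have h5 : (a i : ℝ) + 1 ≤ shiftSeq k a i := by exact_mod_cast hlt
  have h6 : digitVal q a - digitVal q (shiftSeq k a) < 0 := by
    rw [h2, shiftSeq_shiftSeq]
    apply div_neg_of_neg_of_pos (by linarith) (by positivity)
  have := h.le_one k
  rw [h.val] at h6
  linarith

lemma IsUnivoque.reflectSeq (hq : 1 < q) (hc : IsUnivoque q m c) :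
    IsUnivoque q m (reflectSeq m c) := by
  refine ⟨reflectSeq_le m c, fun d hd h => ?_⟩
  rw [← reflectSeq_reflectSeq hd]
  congr 1
  refine hc.2 _ (reflectSeq_le m d) ?_
  rw [digitVal_reflectSeq hq hd, h, digitVal_reflectSeq hq hc.1]
  ring

lemma IsUnivoque.shiftSeq_lexLt (hq : 1 < q) (hm' : q ≤ m + 1) (ha : IsQuasiGreedyUnit q m a)
    (hc : IsUnivoque q m c) {n : ℕ} (hn : c n < m) : LexLt (shiftSeq (n + 1) c) a := by
  by_contra hlt
  have h1 : 1 ≤ digitVal q (shiftSeq (n + 1) c) :=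
    ha.one_le_digitVal hq (fun i => hc.1 (n + 1 + i)) hlt
  obtain ⟨e, he, hev⟩ := exists_digits_of_mem (m := m) hq hm'
    (x := digitVal q (shiftSeq (n + 1) c) - 1) (by linarith)
    (by linarith [digitVal_le (c := shiftSeq (n + 1) c) hq fun i => hc.1 (n + 1 + i)])
  let d : ℕ → ℕ := fun i => if i < n then c i else if i = n then c n + 1 else e (i - (n + 1))
  have hd : ∀ i, d i ≤ m := fun i => by
    simp only [d]
    split_ifs
    · exact hc.1 i
    · exact hn
    · exact he _
  have hds : shiftSeq (n + 1) d = e := by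
    funext i
    simp only [shiftSeq, d]
    rw [if_neg (by omega), if_neg (by omega)]
    congr 1
    omega
  have h2 := digitVal_sub_of_agree (i := n) hq hd hc.1 fun j hj => if_pos hj
  have hdn : d n = c n + 1 := by simp [d]
  rw [hds, hev, hdn] at h2
  have h3 : digitVal q d = digitVal q c := by
    rw [← sub_eq_zero, h2]
    push_cast
    ring
  have h4 := congrFun (hc.2 d hd h3) n
  omega

lemma IsUnivoque.reflectSeq_shiftSeq_lexLt (hq : 1 < q) (hm' : q ≤ m + 1)
    (ha : IsQuasiGreedyUnit q m a) (hc : IsUnivoque q m c) {n : ℕ} (hn : 0 < c n) :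
    LexLt (_root_.reflectSeq m (shiftSeq (n + 1) c)) a := by
  have := hc.1 n
  exact (hc.reflectSeq hq).shiftSeq_lexLt hq hm' ha (n := n)
    (show m - c n < m by omega)

lemma digitVal_shiftSeq_lt_one (hq : 1 < q) (ha : IsQuasiGreedyUnit q m a)
    (hc : ∀ i, c i ≤ m) (h : ∀ n, c n < m → LexLt (shiftSeq (n + 1) c) a) {n : ℕ}
    (hn : c n < m) : digitVal q (shiftSeq (n + 1) c) < 1 := by
  have hP : ∀ k, (∃ n, k = n + 1 ∧ c n < m) → digitVal q (shiftSeq k c) ≤ 1 := by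
    intro k hk
    refine digitVal_le_one_of_lexLe_tails hq ha.le hc ha.val (fun k => ∃ n, k = n + 1 ∧ c n < m)
      ?_ hk
    rintro k ⟨n, rfl, hn⟩
    obtain ⟨i, hi, hlt⟩ := h n hn
    exact Or.inr ⟨i, hi, hlt, _, rfl, lt_of_lt_of_le hlt (ha.le i)⟩
  obtain ⟨i, hi, hlt⟩ := h n hn
  have h1 := digitVal_sub_of_agree (a := shiftSeq (n + 1) c) hq (fun i => hc _) ha.le hi
  rw [shiftSeq_shiftSeq, ha.val] at h1
  have h2 := hP (n + 1 + (i + 1)) ⟨n + 1 + i, rfl, lt_of_lt_of_le hlt (ha.le i)⟩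
  have h3 := ha.pos (i + 1)
  have h4 : (shiftSeq (n + 1) c i : ℝ) + 1 ≤ a i := by exact_mod_cast hlt
  have h5 : digitVal q (shiftSeq (n + 1) c) - 1 < 0 := by
    rw [h1]
    apply div_neg_of_neg_of_pos (by linarith) (by positivity)
  linarith

lemma not_lt_at_first_difference (hq : 1 < q) (ha : IsQuasiGreedyUnit q m a)
    (hc : ∀ i, c i ≤ m) (h : ∀ n, c n < m → LexLt (shiftSeq (n + 1) c) a) (hd : ∀ i, d i ≤ m)
    (hdc : digitVal q d = digitVal q c) {n : ℕ} (hn : ∀ j < n, c j = d j) : ¬ c n < d n := by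
  intro hlt
  have h1 := digitVal_sub_of_agree hq hc hd hn
  rw [hdc, sub_self, eq_comm, div_eq_zero_iff, or_iff_left (by positivity)] at h1
  have h2 := digitVal_shiftSeq_lt_one hq ha hc h (lt_of_lt_of_le hlt (hd n))
  have h3 := digitVal_nonneg hq (shiftSeq (n + 1) d)
  have h4 : (c n : ℝ) + 1 ≤ d n := by exact_mod_cast hlt
  linarith

lemma isUnivoque_of_lexLt (hq : 1 < q) (ha : IsQuasiGreedyUnit q m a) (hc : ∀ i, c i ≤ m)
    (h : ∀ n, c n < m → LexLt (shiftSeq (n + 1) c) a)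
    (h' : ∀ n, 0 < c n → LexLt (reflectSeq m (shiftSeq (n + 1) c)) a) : IsUnivoque q m c := by
  refine ⟨hc, fun d hd hdc => ?_⟩
  rcases lexLt_trichotomy c d with ⟨n, hn, hlt⟩ | h1 | ⟨n, hn, hlt⟩
  · exact absurd hlt (not_lt_at_first_difference hq ha hc h hd hdc hn)
  · exact h1.symm
  · refine absurd ?_ (not_lt_at_first_difference (c := reflectSeq m c) (d := reflectSeq m d)
      (n := n) hq ha (reflectSeq_le m c) (fun k hk => h' k ?_) (reflectSeq_le m d) ?_ ?_)
    · have := hc n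
      simp only [reflectSeq]; omega
    · simp only [reflectSeq] at hk; omega
    · rw [digitVal_reflectSeq hq hd, digitVal_reflectSeq hq hc, hdc]
    · intro j hj
      simp only [reflectSeq, hn j hj]

lemma isQuasiGreedyUnit_of_isShiftMaximal (hq : 1 < q) (ha : ∀ i, a i ≤ m)
    (hval : digitVal q a = 1) (hs : IsShiftMaximal a) (h0 : ∀ n, ∃ i, a (n + i) ≠ 0) :
    IsQuasiGreedyUnit q m a := by
  refine ⟨ha, hval, fun n => ?_, fun n => ?_⟩
  · obtain ⟨i, hi⟩ := h0 n
    exact digitVal_pos (c := shiftSeq n a) hq (fun i => ha _) hi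
  · refine digitVal_le_one_of_lexLe_tails hq ha ha hval (fun _ => True) (fun k _ => ?_) trivial
    rcases lexLt_trichotomy (shiftSeq k a) a with ⟨i, hi, hlt⟩ | h | h
    · exact Or.inr ⟨i, hi, hlt, trivial⟩
    · exact Or.inl h
    · exact absurd h (hs k)

lemma exists_ne_zero_of_not_lexLt_reflectSeq (ha : ∀ i, a i ≤ m) (hm : 0 < m) {k : ℕ}
    (h : ¬ LexLt a (reflectSeq m (shiftSeq k a))) : ∃ i, a (k + i) ≠ 0 := by
  by_contra! h0
  have hr : ∀ i, reflectSeq m (shiftSeq k a) i = m := fun i => by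
    simp [reflectSeq, shiftSeq, h0 i]
  rcases lexLt_trichotomy a (reflectSeq m (shiftSeq k a)) with h1 | h1 | ⟨i, -, hlt⟩
  · exact h h1
  · have h2 := congrFun h1 k
    have h3 := h0 0
    rw [hr] at h2
    rw [add_zero] at h3
    omega
  · rw [hr] at hlt
    have := ha i
    omega

end Univoque

/-! ### Combinatorics of shift-maximal sequences -/

section Combinatorics

variable {m N : ℕ} {a c : ℕ → ℕ}

lemma reflectSeq_shiftSeq_succ_lexLt (hs : IsShiftMaximal a) (h0 : a 0 = m) {j : ℕ}
    (hj : a j = 0) (h : LexLt (reflectSeq m (shiftSeq j a)) a) :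
    LexLt (reflectSeq m (shiftSeq (j + 1) a)) a := by
  obtain ⟨i, hi, hlt⟩ := h
  cases i with
  | zero => simp [reflectSeq, shiftSeq, hj, h0] at hlt
  | succ i =>
    have h1 : LexLt (reflectSeq m (shiftSeq (j + 1) a)) (shiftSeq 1 a) := by
      refine ⟨i, fun l hl => ?_, ?_⟩
      · have := hi (l + 1) (by omega)
        simp only [reflectSeq, shiftSeq] at this ⊢
        rw [add_comm 1 l, ← this]
        congr 2
        omega
      · simp only [reflectSeq, shiftSeq] at hlt ⊢
        rw [add_comm 1 i]
        convert hlt using 3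
        omega
    rcases lexLt_trichotomy (shiftSeq 1 a) a with h2 | h2 | h2
    · exact h1.trans h2
    · rwa [h2] at h1
    · exact absurd h2 (hs 1)

lemma reflectSeq_shiftSeq_zero_lexLt (hm : 0 < m) (h0 : a 0 = m) :
    LexLt (reflectSeq m (shiftSeq 0 a)) a :=
  ⟨0, by simp, by simp [reflectSeq, shiftSeq, h0, hm]⟩

/-- If `a` agrees with a sequence satisfying `a_{k+i} = m - a_i` on its first `2k` terms, then
`a` cannot be both shift-maximal and reflect-dominated. -/
lemma IsReflectDominated.false_of_agree (hc : IsReflectDominated m c) (hs : IsShiftMaximal c)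
    (ha : ∀ i, a i ≤ m) {k : ℕ} (hk : 0 < k) (hak : ∀ i, m - a (k + i) = a i)
    (hca : ∀ i < 2 * k, c i = a i) : False := by
  have hper : ∀ i, a (2 * k + i) = a i := fun i => by
    have h1 := hak i
    have h2 := hak (k + i)
    have h3 := ha (2 * k + i)
    rw [← add_assoc, ← two_mul] at h2
    omega
  rcases lexLt_trichotomy c a with ⟨i, hi, hlt⟩ | h | ⟨i, hi, hlt⟩
  · have hik : 2 * k ≤ i := by
      by_contra h
      exact hlt.ne (hca i (by omega))
    obtain ⟨t, rfl⟩ : ∃ t, i = k + t := ⟨i - k, by omega⟩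
    have h1 : LexLt c (reflectSeq m (shiftSeq k c)) := by
      refine ⟨t, fun j hj => ?_, ?_⟩
      · simp only [reflectSeq, shiftSeq]
        rw [hi (k + j) (by omega), hak, hi j (by omega)]
      · simp only [reflectSeq, shiftSeq]
        rw [hi t (by omega), ← hak t]
        have := ha (k + t)
        omega
    exact lexLt_irrefl _ (h1.trans (hc k))
  · subst h
    have h1 : reflectSeq m (shiftSeq k c) = c := funext hak
    have h2 := hc k
    rw [h1] at h2
    exact lexLt_irrefl _ h2
  · have hik : 2 * k ≤ i := by
      by_contra h
      exact hlt.ne (hca i (by omega)).symm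
    obtain ⟨t, rfl⟩ : ∃ t, i = 2 * k + t := ⟨i - 2 * k, by omega⟩
    refine hs (2 * k) ⟨t, fun j hj => ?_, ?_⟩
    · simp only [shiftSeq]
      rw [← hi (2 * k + j) (by omega), hper, hi j (by omega)]
    · simp only [shiftSeq]
      rw [← hi t (by omega), ← hper t]
      exact hlt

/-- Every nonempty suffix of the word `a_0 … a_{N-1}` has a reflection which is smaller, at some
position of the suffix, than the prefix of the same length. -/
def IsReflectDominatedPrefix (m : ℕ) (a : ℕ → ℕ) (N : ℕ) : Prop :=
  ∀ k < N, ∃ i, k + i < N ∧ (∀ l < i, m - a (k + l) = a l) ∧ m - a (k + i) < a i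

lemma IsReflectDominatedPrefix.last_pos (h : IsReflectDominatedPrefix m a N) (h0 : a 0 = m)
    (hN : 0 < N) : 0 < a (N - 1) := by
  obtain ⟨i, hi, -, hlt⟩ := h (N - 1) (by omega)
  obtain rfl : i = 0 := by omega
  rw [h0, add_zero] at hlt
  omega

lemma exists_isReflectDominatedPrefix_succ (hs : IsShiftMaximal a) (hK : IsReflectDominated m a)
    (hN : IsReflectDominatedPrefix m a N) : ∃ N' > N, IsReflectDominatedPrefix m a N' := by
  obtain ⟨i, hi, hlt⟩ := hK N
  simp only [reflectSeq, shiftSeq] at hi hlt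
  refine ⟨N + i + 1, by omega, fun k hk => ?_⟩
  rcases lt_trichotomy k N with hkN | rfl | hkN
  · obtain ⟨i', h1, h2⟩ := hN k hkN
    exact ⟨i', by omega, h2⟩
  · exact ⟨i, by omega, hi, hlt⟩
  · obtain ⟨t, rfl⟩ : ∃ t, k = N + t := ⟨k - N, by omega⟩
    obtain ⟨i', h1, h2⟩ := hK (N + t)
    simp only [reflectSeq, shiftSeq] at h1 h2
    by_cases hi' : N + t + i' < N + i + 1
    · exact ⟨i', hi', h1, h2⟩
    · exfalso
      refine hs t ⟨i - t, fun l hl => ?_, ?_⟩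
      · have h3 := hi (t + l) (by omega)
        rw [← add_assoc, h1 l (by omega)] at h3
        exact h3
      · have h3 := h1 (i - t) (by omega)
        have h4 : N + t + (i - t) = N + i := by omega
        have h5 : t + (i - t) = i := by omega
        simp only [shiftSeq]
        rw [h4] at h3
        rw [h5, ← h3]
        exact hlt

lemma exists_isReflectDominatedPrefix_ge (hs : IsShiftMaximal a) (hK : IsReflectDominated m a)
    (n : ℕ) : ∃ N ≥ n, IsReflectDominatedPrefix m a N := by
  induction n with
  | zero => exact ⟨0, le_rfl, fun k hk => absurd hk (by omega)⟩
  | succ n ih =>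
    obtain ⟨N, hN, h⟩ := ih
    obtain ⟨N', hN', hdom⟩ := exists_isReflectDominatedPrefix_succ hs hK h
    exact ⟨N', by omega, hdom⟩

/-- The periodic sequence with period `a_0 … a_{N-2} (a_{N-1} - 1)`. -/
def lowerPeriodic (N : ℕ) (a : ℕ → ℕ) : ℕ → ℕ :=
  fun i => if i % N = N - 1 then a (N - 1) - 1 else a (i % N)

lemma lowerPeriodic_of_lt {i : ℕ} (hi : i < N - 1) : lowerPeriodic N a i = a i := by
  rw [lowerPeriodic, Nat.mod_eq_of_lt (by omega), if_neg (by omega)]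

lemma lowerPeriodic_last (hN : 0 < N) : lowerPeriodic N a (N - 1) = a (N - 1) - 1 := by
  rw [lowerPeriodic, Nat.mod_eq_of_lt (by omega), if_pos rfl]

lemma lowerPeriodic_le (ha : ∀ i, a i ≤ m) (i : ℕ) : lowerPeriodic N a i ≤ m := by
  have h1 := ha (N - 1)
  have h2 := ha (i % N)
  unfold lowerPeriodic
  split_ifs <;> omega

lemma lowerPeriodic_add (i : ℕ) : lowerPeriodic N a (N + i) = lowerPeriodic N a i := by
  simp only [lowerPeriodic, Nat.add_mod_left]

lemma shiftSeq_lowerPeriodic_mod (k : ℕ) :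
    shiftSeq k (lowerPeriodic N a) = shiftSeq (k % N) (lowerPeriodic N a) := by
  funext i
  simp only [shiftSeq, lowerPeriodic, Nat.mod_add_mod]

lemma shiftSeq_lowerPeriodic_lexLt (hs : IsShiftMaximal a) (h0 : a 0 = m) (hN : 2 ≤ N)
    (hg : IsReflectDominatedPrefix m a N) (k : ℕ) : LexLt (shiftSeq k (lowerPeriodic N a)) a := by
  rw [shiftSeq_lowerPeriodic_mod]
  have hk : k % N < N := Nat.mod_lt _ (by omega)
  generalize k % N = k at hk
  have hpos := hg.last_pos h0 (by omega)
  have hlast : k + (N - 1 - k) = N - 1 := by omega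
  have key : (∀ l < N - 1 - k, a (k + l) = a l) → a (N - 1) ≤ a (N - 1 - k) →
      LexLt (shiftSeq k (lowerPeriodic N a)) a := fun h1 h2 => by
    refine ⟨N - 1 - k, fun l hl => ?_, ?_⟩
    · simp only [shiftSeq]
      rw [lowerPeriodic_of_lt (by omega), h1 l hl]
    · simp only [shiftSeq]
      rw [hlast, lowerPeriodic_last (by omega)]
      omega
  rcases lexLt_trichotomy (shiftSeq k a) a with ⟨i, hi, hlt⟩ | h | h
  · simp only [shiftSeq] at hi hlt
    rcases lt_trichotomy i (N - 1 - k) with hik | rfl | hik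
    · refine ⟨i, fun l hl => ?_, ?_⟩ <;> simp only [shiftSeq] <;> rw [lowerPeriodic_of_lt (by omega)]
      · exact hi l hl
      · exact hlt
    · rw [hlast] at hlt
      exact key hi hlt.le
    · have h1 := hi _ hik
      rw [hlast] at h1
      exact key (fun l hl => hi l (by omega)) h1.le
  · have h1 := congrFun h (N - 1 - k)
    simp only [shiftSeq, hlast] at h1
    exact key (fun l _ => congrFun h l) h1.le
  · exact absurd h (hs k)

lemma reflectSeq_shiftSeq_lowerPeriodic_lexLt (hm : 0 < m) (ha : ∀ i, a i ≤ m) (h0 : a 0 = m)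
    (hN : 2 ≤ N) (hg : IsReflectDominatedPrefix m a N) (k : ℕ) :
    LexLt (reflectSeq m (shiftSeq k (lowerPeriodic N a))) a := by
  rw [shiftSeq_lowerPeriodic_mod]
  have hk : k % N < N := Nat.mod_lt _ (by omega)
  generalize k % N = k at hk
  rcases Nat.eq_zero_or_pos k with rfl | hk0
  · refine ⟨0, by simp, ?_⟩
    simp only [reflectSeq, shiftSeq]
    rw [lowerPeriodic_of_lt (by omega), add_zero, h0]
    omega
  obtain ⟨i, hi, hi1, hlt⟩ := hg k hk
  rcases (show i < N - 1 - k ∨ i = N - 1 - k by omega) with hik | hik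
  · refine ⟨i, fun l hl => ?_, ?_⟩ <;> simp only [reflectSeq, shiftSeq] <;>
      rw [lowerPeriodic_of_lt (by omega)]
    · exact hi1 l hl
    · exact hlt
  have hpos := hg.last_pos h0 (by omega)
  have hlast : k + i = N - 1 := by omega
  have hle := ha (N - 1)
  have hfirst : ∀ l < i, m - lowerPeriodic N a (k + l) = a l := fun l hl => by
    rw [lowerPeriodic_of_lt (by omega), hi1 l hl]
  have hd : m - lowerPeriodic N a (k + i) = m - a (k + i) + 1 := by
    rw [hlast, lowerPeriodic_last (by omega)]
    omega
  rcases (show m - a (k + i) + 1 < a i ∨ m - a (k + i) + 1 = a i by omega) with hlt' | heq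
  · refine ⟨i, hfirst, ?_⟩
    simp only [reflectSeq, shiftSeq]
    omega
  · obtain ⟨j, hj, hj1, hjlt⟩ := hg (i + 1) (by omega)
    have hle' := ha (i + 1 + j)
    refine ⟨i + 1 + j, fun l hl => ?_, ?_⟩ <;> simp only [reflectSeq, shiftSeq]
    · rcases lt_trichotomy l i with h | rfl | h
      · exact hfirst l h
      · omega
      · obtain ⟨t, rfl⟩ : ∃ t, l = i + 1 + t := ⟨l - (i + 1), by omega⟩
        rw [show k + (i + 1 + t) = N + t by omega, lowerPeriodic_add,
          lowerPeriodic_of_lt (by omega), ← hj1 t (by omega)]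
        have := ha (i + 1 + t)
        omega
    · rw [show k + (i + 1 + j) = N + j by omega, lowerPeriodic_add,
        lowerPeriodic_of_lt (by omega)]
      have := ha j
      omega

/-! ### A doubling construction -/

/-- The word `a_0 … a_{N-1}` has no suffix larger than the prefix of the same length, and it is
reflect-dominated. -/
structure IsAdmissibleWord (m N : ℕ) (a : ℕ → ℕ) : Prop where
  pos : 0 < N
  le : ∀ i, a i ≤ m
  head : a 0 = m
  suffix_le : ∀ k i, k + i < N → (∀ l < i, a (k + l) = a l) → a (k + i) ≤ a i
  dominated : IsReflectDominatedPrefix m a N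

/-- Extends `a_0 … a_{N-1}` by its reflection with the last digit increased by one. -/
def doubleWord (m N : ℕ) (a : ℕ → ℕ) : ℕ → ℕ := fun i =>
  if i < N then a i else if i = 2 * N - 1 then m - a (N - 1) + 1 else m - a (i - N)

lemma doubleWord_of_lt {i : ℕ} (hi : i < N) : doubleWord m N a i = a i := if_pos hi

lemma doubleWord_add {i : ℕ} (hi : i < N - 1) : doubleWord m N a (N + i) = m - a i := by
  rw [doubleWord, if_neg (by omega), if_neg (by omega)]
  congr 2
  omega

lemma doubleWord_last (hN : 0 < N) :
    doubleWord m N a (N + (N - 1)) = m - a (N - 1) + 1 := by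
  rw [doubleWord, if_neg (by omega), if_pos (by omega)]

lemma IsAdmissibleWord.exists_first_lt (h : IsAdmissibleWord m N a) {k : ℕ} (hk : 0 < k)
    (hkN : k < N) : ∃ i, k + i < 2 * N ∧
      (∀ l < i, doubleWord m N a (k + l) = doubleWord m N a l) ∧
      doubleWord m N a (k + i) < doubleWord m N a i := by
  by_cases hall : ∃ i, k + i < N ∧ a (k + i) ≠ a i
  · obtain ⟨hi, hne⟩ := Nat.find_spec hall
    have hmin : ∀ l < Nat.find hall, a (k + l) = a l := fun l hl => by
      by_contra hne'
      exact Nat.find_min hall hl ⟨by omega, hne'⟩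
    refine ⟨Nat.find hall, by omega, fun l hl => ?_, ?_⟩
    · rw [doubleWord_of_lt (by omega), doubleWord_of_lt (by omega), hmin l hl]
    · rw [doubleWord_of_lt hi, doubleWord_of_lt (by omega)]
      exact lt_of_le_of_ne (h.suffix_le _ _ hi hmin) hne
  · push Not at hall
    obtain ⟨i, hi, hi1, hlt⟩ := h.dominated (N - k) (by omega)
    refine ⟨N - k + i, by omega, fun l hl => ?_, ?_⟩
    · by_cases hl' : k + l < N
      · rw [doubleWord_of_lt hl', doubleWord_of_lt (by omega), hall l hl']
      · obtain ⟨t, rfl⟩ : ∃ t, l = N - k + t := ⟨l - (N - k), by omega⟩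
        rw [show k + (N - k + t) = N + t by omega, doubleWord_add (by omega),
          doubleWord_of_lt (by omega), ← hi1 t (by omega)]
        have := h.le (N - k + t)
        omega
    · rw [show k + (N - k + i) = N + i by omega, doubleWord_add (by omega),
        doubleWord_of_lt (by omega)]
      have := h.le i
      omega

lemma IsAdmissibleWord.doubleWord (h : IsAdmissibleWord m N a) :
    IsAdmissibleWord m (2 * N) (doubleWord m N a) := by
  have hN := h.pos
  have hpos := h.dominated.last_pos h.head hN
  have hlast := h.le (N - 1)
  refine ⟨by omega, fun i => ?_, ?_, fun k i hki hl => ?_, fun k hk => ?_⟩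
  · have h1 := h.le i
    have h2 := h.le (i - N)
    unfold _root_.doubleWord
    split_ifs <;> omega
  · rw [doubleWord_of_lt hN, h.head]
  · rcases lt_or_ge k N with hkN | hkN
    · rcases Nat.eq_zero_or_pos k with rfl | hk0
      · rw [zero_add]
      · obtain ⟨i', -, h2, h3⟩ := h.exists_first_lt hk0 hkN
        rcases lt_trichotomy i i' with h4 | rfl | h4
        · exact (h2 i h4).le
        · exact h3.le
        · exact absurd (hl i' h4) h3.ne
    · obtain ⟨t, rfl⟩ : ∃ t, k = N + t := ⟨k - N, by omega⟩
      obtain ⟨i', h1, h2, h3⟩ := h.dominated t (by omega)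
      rw [doubleWord_of_lt (i := i) (by omega), add_assoc]
      rcases lt_trichotomy i i' with h4 | rfl | h4
      · rw [doubleWord_add (by omega), h2 i h4]
      · rcases (show t + i < N - 1 ∨ t + i = N - 1 by omega) with h5 | h5
        · rw [doubleWord_add h5]
          exact h3.le
        · rw [h5] at h3 ⊢
          rw [doubleWord_last hN]
          omega
      · have h5 := hl i' h4
        rw [add_assoc, doubleWord_add (by omega), doubleWord_of_lt (by omega)] at h5
        omega
  · rcases lt_or_ge k N with hkN | hkN
    · obtain ⟨i, h1, h2, h3⟩ := h.dominated k hkN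
      refine ⟨i, by omega, fun l hl => ?_, ?_⟩ <;>
        rw [doubleWord_of_lt (by omega), doubleWord_of_lt (by omega)]
      · exact h2 l hl
      · exact h3
    · obtain ⟨t, rfl⟩ : ∃ t, k = N + t := ⟨k - N, by omega⟩
      by_cases hall : ∃ i, t + i < N - 1 ∧ a (t + i) ≠ a i
      · obtain ⟨hi, hne⟩ := Nat.find_spec hall
        have hmin : ∀ l < Nat.find hall, a (t + l) = a l := fun l hl => by
          by_contra hne'
          exact Nat.find_min hall hl ⟨by omega, hne'⟩
        refine ⟨Nat.find hall, by omega, fun l hl => ?_, ?_⟩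
        · rw [add_assoc, doubleWord_add (by omega), doubleWord_of_lt (by omega), ← hmin l hl]
          have := h.le (t + l)
          omega
        · rw [add_assoc, doubleWord_add hi, doubleWord_of_lt (by omega)]
          have h1 := lt_of_le_of_ne (h.suffix_le _ _ (by omega) hmin) hne
          have := h.le (t + Nat.find hall)
          omega
      · push Not at hall
        have ht : t + (N - 1 - t) = N - 1 := by omega
        refine ⟨N - 1 - t, by omega, fun l hl => ?_, ?_⟩
        · rw [add_assoc, doubleWord_add (by omega), doubleWord_of_lt (by omega),
            ← hall l (by omega)]
          have := h.le (t + l)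
          omega
        · have h1 := h.suffix_le t (N - 1 - t) (by omega) fun l hl => hall l (by omega)
          rw [add_assoc, ht, doubleWord_last hN, doubleWord_of_lt (by omega)]
          rw [ht] at h1
          omega

/-- The `j`-fold iterate of `doubleWord`. -/
def doubleIter (m N : ℕ) (a : ℕ → ℕ) : ℕ → ℕ → ℕ
  | 0 => a
  | j + 1 => doubleWord m (2 ^ j * N) (doubleIter m N a j)

lemma IsAdmissibleWord.doubleIter (h : IsAdmissibleWord m N a) (j : ℕ) :
    IsAdmissibleWord m (2 ^ j * N) (doubleIter m N a j) := by
  induction j with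
  | zero => simpa [_root_.doubleIter] using h
  | succ j ih =>
    rw [pow_succ', mul_assoc]
    exact ih.doubleWord

lemma doubleIter_eq_of_le {i j k : ℕ} (hjk : j ≤ k) (hi : i < 2 ^ j * N) :
    doubleIter m N a k i = doubleIter m N a j i := by
  induction k, hjk using Nat.le_induction with
  | base => rfl
  | succ k hjk ih =>
    rw [doubleIter, doubleWord_of_lt, ih]
    exact lt_of_lt_of_le hi (Nat.mul_le_mul_right _ (Nat.pow_le_pow_right (by norm_num) hjk))

lemma lt_two_pow_mul (hN : 0 < N) (i : ℕ) : i < 2 ^ i * N :=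
  lt_of_lt_of_le i.lt_two_pow_self (Nat.le_mul_of_pos_right _ hN)

/-- A word as in `IsAdmissibleWord` is a prefix of a sequence that strictly dominates its proper
tails and their reflections. -/
lemma IsAdmissibleWord.exists_extension (h : IsAdmissibleWord m N a) :
    ∃ c : ℕ → ℕ, (∀ i, c i ≤ m) ∧ c 0 = m ∧ (∀ i < N, c i = a i) ∧
      (∀ k, 0 < k → LexLt (shiftSeq k c) c) ∧ IsReflectDominated m c := by
  let c : ℕ → ℕ := fun i => _root_.doubleIter m N a i i
  have hc : ∀ i j, i < 2 ^ j * N → c i = _root_.doubleIter m N a j i := fun i j hij => by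
    rcases le_total i j with h1 | h1
    · exact (doubleIter_eq_of_le h1 (lt_two_pow_mul h.pos i)).symm
    · exact doubleIter_eq_of_le h1 hij
  refine ⟨c, fun i => (h.doubleIter i).le i, h.head, fun i hi => hc i 0 (by simpa using hi),
    fun k hk => ?_, fun k => ?_⟩
  · obtain ⟨i, h1, h2, h3⟩ := (h.doubleIter k).exists_first_lt hk (lt_two_pow_mul h.pos k)
    have hc' : ∀ l, l < 2 * (2 ^ k * N) →
        c l = _root_.doubleWord m (2 ^ k * N) (_root_.doubleIter m N a k) l := fun l hl =>
      hc l (k + 1) (by rwa [pow_succ', mul_assoc])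
    refine ⟨i, fun l hl => ?_, ?_⟩ <;> simp only [shiftSeq] <;>
      rw [hc' _ (by omega), hc' _ (by omega)]
    · exact h2 l hl
    · exact h3
  · obtain ⟨i, h1, h2, h3⟩ := (h.doubleIter k).dominated k (lt_two_pow_mul h.pos k)
    refine ⟨i, fun l hl => ?_, ?_⟩ <;> simp only [reflectSeq, shiftSeq] <;>
      rw [hc _ k (by omega), hc _ k (by omega)]
    · exact h2 l hl
    · exact h3

end Combinatorics

/-! ### The closure of the set of univoque bases -/

section Closure

variable {q : ℝ} {m : ℕ} {a c : ℕ → ℕ}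

lemma exists_isReflectDominated_of_mem_USet (hm : 0 < m) (hqm : alphaOne q = m) (hq : q ∈ USet) :
    ∃ a, IsQuasiGreedyUnit q m a ∧ IsReflectDominated m a := by
  obtain ⟨h1, c, hc1, hc⟩ := mem_USet_iff.1 hq
  rw [hqm] at hc
  obtain ⟨hq1, hq2⟩ := (alphaOne_eq_iff h1).1 hqm
  obtain ⟨a, ha⟩ := exists_isQuasiGreedyUnit h1 hq2
  obtain rfl : a = c := hc.2 a ha.le (ha.val.trans hc1.symm)
  have h0 := ha.head_eq h1 hq1
  refine ⟨a, ha, fun k => ?_⟩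
  induction k with
  | zero => exact reflectSeq_shiftSeq_zero_lexLt hm h0
  | succ j ih =>
    rcases Nat.eq_zero_or_pos (a j) with hj | hj
    · exact reflectSeq_shiftSeq_succ_lexLt (ha.isShiftMaximal h1) h0 hj ih
    · exact hc.reflectSeq_shiftSeq_lexLt h1 hq2 ha hj

lemma exists_isReflectDominated_of_mem_closure (hm : 0 < m) (hq1 : 1 < q) (hmq : (m : ℝ) < q)
    (hqm : q < m + 1) (hq : q ∈ closure USet) :
    ∃ a, IsQuasiGreedyUnit q m a ∧ IsReflectDominated m a := by
  obtain ⟨u, hu, huq⟩ := mem_closure_iff_ultrafilter.1 hq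
  have hev : ∀ᶠ p in (u : Filter ℝ), ∃ c : ℕ → ℕ, (∀ i, c i ≤ m) ∧ digitVal p c = 1 ∧
      c 0 = m ∧ IsShiftMaximal c ∧ IsReflectDominated m c := by
    filter_upwards [hu, huq (lt_mem_nhds hq1), huq (lt_mem_nhds hmq), huq (gt_mem_nhds hqm)]
      with p hp h1 h2 h3
    obtain ⟨c, hc, hK⟩ := exists_isReflectDominated_of_mem_USet hm
      ((alphaOne_eq_iff h1).2 ⟨h2, h3.le⟩) hp
    exact ⟨c, hc.le, hc.val, hc.head_eq h1 h2, hc.isShiftMaximal h1, hK⟩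
  obtain ⟨C, hC⟩ := hev.choice
  have hlim : ∀ i, ∃ v, ∀ᶠ p in (u : Filter ℝ), C p i = v := fun i => by
    have h := (Ultrafilter.eventually_exists_mem_iff (f := u) (P := fun v p => C p i = v)
      (Set.finite_Iic m)).1 (hC.mono fun p hp => ⟨_, hp.1 i, rfl⟩)
    obtain ⟨v, -, hv⟩ := h
    exact ⟨v, hv⟩
  choose a ha using hlim
  have hpre : ∀ n, ∀ᶠ p in (u : Filter ℝ), ∀ i < n, C p i = a i := fun n =>
    (Set.finite_Iio n).eventually_all.2 fun i _ => ha i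
  have hle : ∀ i, a i ≤ m := fun i => by
    obtain ⟨p, hp, hpi⟩ := (hC.and (ha i)).exists
    exact hpi ▸ hp.1 i
  have h0 : a 0 = m := by
    obtain ⟨p, hp, hpi⟩ := (hC.and (ha 0)).exists
    exact hpi ▸ hp.2.2.1
  have hval : digitVal q a = 1 := by
    have h1 := tendsto_digitVal (p := id) hq1 huq (hC.mono fun p hp => hp.1) ha
    exact tendsto_nhds_unique h1
      (tendsto_const_nhds.congr' (hC.mono fun p hp => hp.2.1.symm))
  have hs : IsShiftMaximal a := by
    rintro k ⟨i, hi, hlt⟩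
    obtain ⟨p, hp, hpi⟩ := (hC.and (hpre (k + i + 1))).exists
    refine hp.2.2.2.1 k ⟨i, fun j hj => ?_, ?_⟩ <;> simp only [shiftSeq] at hi hlt ⊢ <;>
      rw [hpi _ (by omega), hpi _ (by omega)]
    · exact hi j hj
    · exact hlt
  have hr : ∀ k, ¬ LexLt a (reflectSeq m (shiftSeq k a)) := by
    rintro k ⟨i, hi, hlt⟩
    obtain ⟨p, hp, hpi⟩ := (hC.and (hpre (k + i + 1))).exists
    refine lexLt_irrefl (C p) (LexLt.trans ⟨i, fun j hj => ?_, ?_⟩ (hp.2.2.2.2 k)) <;>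
      simp only [reflectSeq, shiftSeq] at hi hlt ⊢ <;>
      rw [hpi _ (by omega), hpi _ (by omega)]
    · exact hi j hj
    · exact hlt
  refine ⟨a, isQuasiGreedyUnit_of_isShiftMaximal hq1 hle hval hs fun n =>
    exists_ne_zero_of_not_lexLt_reflectSeq hle hm (hr n), fun k => ?_⟩
  rcases lexLt_trichotomy (reflectSeq m (shiftSeq k a)) a with h | h | h
  · exact h
  · exfalso
    have hk : 0 < k := by
      rcases Nat.eq_zero_or_pos k with rfl | hk
      · have h2 := reflectSeq_shiftSeq_zero_lexLt hm h0
        rw [h] at h2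
        exact absurd h2 (lexLt_irrefl a)
      · exact hk
    obtain ⟨p, hp, hpi⟩ := (hC.and (hpre (2 * k))).exists
    exact hp.2.2.2.2.false_of_agree hp.2.2.2.1 hle hk (congrFun h) hpi
  · exact absurd h (hr k)

lemma isReflectDominated_const (hm : 0 < m) : IsReflectDominated m fun _ => m := fun k =>
  ⟨0, by simp, by simp [reflectSeq, shiftSeq, hm]⟩

lemma isQuasiGreedyUnit_const (hm : 0 < m) :
    IsQuasiGreedyUnit (m + 1 : ℝ) m fun _ => m := by
  have h : digitVal (m + 1 : ℝ) (fun _ => m) = 1 := by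
    have h0 : (m : ℝ) ≠ 0 := by positivity
    rw [digitVal_const (by simpa using hm), add_sub_cancel_right, div_self h0]
  exact ⟨fun _ => le_rfl, h, fun n => h.symm ▸ one_pos, fun n => h.le⟩

lemma mem_USet_of_isReflectDominated (hq : 1 < q) (hmq : (m : ℝ) < q) (hqm : q ≤ m + 1)
    (hm : 0 < m) (hc : ∀ i, c i ≤ m) (hval : digitVal q c = 1)
    (hs : ∀ k, 0 < k → LexLt (shiftSeq k c) c) (hK : IsReflectDominated m c) : q ∈ USet := by
  have hmax : IsShiftMaximal c := fun k hk => by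
    rcases Nat.eq_zero_or_pos k with rfl | hk0
    · rw [shiftSeq_zero] at hk
      exact lexLt_irrefl _ hk
    · exact lexLt_irrefl _ (hk.trans (hs k hk0))
  have hqg : IsQuasiGreedyUnit q m c :=
    isQuasiGreedyUnit_of_isShiftMaximal hq hc hval hmax fun n =>
      exists_ne_zero_of_not_lexLt_reflectSeq hc hm fun h => lexLt_irrefl _ (h.trans (hK n))
  refine mem_USet_iff.2 ⟨hq, c, hval, ?_⟩
  rw [(alphaOne_eq_iff hq).2 ⟨hmq, hqm⟩]
  exact isUnivoque_of_lexLt hq hqg hc (fun n _ => hs _ n.succ_pos) fun n _ => hK _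

lemma digitVal_lt_digitVal {p : ℝ} (hp : 1 < p) (hpq : p < q) (hc : ∀ i, c i ≤ m) (hm : 0 < m)
    (h0 : c 0 = m) : digitVal q c < digitVal p c := by
  have hp0 : 0 < p := by positivity
  have hle : ∀ i, (c i : ℝ) / q ^ (i + 1) ≤ (c i : ℝ) / p ^ (i + 1) := fun i => by gcongr
  refine (summable_digits (hp.trans hpq) hc).tsum_lt_tsum (i := 0) hle ?_ (summable_digits hp hc)
  have : (0 : ℝ) < c 0 := by rw [h0]; exact_mod_cast hm
  simp only [zero_add, pow_one]
  gcongr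

lemma continuousAt_digitVal (hq : 1 < q) (hc : ∀ i, c i ≤ m) :
    ContinuousAt (fun p => digitVal p c) q :=
  tendsto_digitVal (p := fun x => x) (e := fun _ => c) hq Filter.tendsto_id
    (Filter.Eventually.of_forall fun _ => hc) fun _ => Filter.Eventually.of_forall fun _ => rfl

lemma mem_closure_USet (hm : 0 < m) (hq : 1 < q) (hmq : (m : ℝ) < q) (hqm : q ≤ m + 1)
    (ha : IsQuasiGreedyUnit q m a) (hK : IsReflectDominated m a) : q ∈ closure USet := by
  have h0 := ha.head_eq hq hmq
  have hs := ha.isShiftMaximal hq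
  have hm1 : (1 : ℝ) ≤ m := by exact_mod_cast hm
  have hex : ∀ n : ℕ, ∃ c : ℕ → ℕ, (∀ i, c i ≤ m) ∧ (∀ i < n, c i = a i) ∧
      (∀ k, 0 < k → LexLt (shiftSeq k c) c) ∧ IsReflectDominated m c := fun n => by
    obtain ⟨N, hN, hg⟩ := exists_isReflectDominatedPrefix_ge hs hK (n + 1)
    have hw : IsAdmissibleWord m N a := ⟨by omega, ha.le, h0, fun k i _ h => by
      by_contra hlt
      exact hs k ⟨i, fun l hl => (h l hl).symm, not_le.1 hlt⟩, hg⟩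
    obtain ⟨c, h1, -, h2, h3⟩ := hw.exists_extension
    exact ⟨c, h1, fun i hi => h2 i (by omega), h3⟩
  choose C hCle hCa hCs hCK using hex
  have hCev : ∀ i, ∀ᶠ n in Filter.atTop, C n i = a i := fun i =>
    (Filter.eventually_gt_atTop i).mono fun n hn => hCa n i hn
  have hlim : ∀ p : ℝ, 1 < p →
      Filter.Tendsto (fun n => digitVal p (C n)) Filter.atTop (nhds (digitVal p a)) := fun p hp =>
    tendsto_digitVal hp tendsto_const_nhds (Filter.Eventually.of_forall hCle) hCev
  refine Metric.mem_closure_iff.2 fun ε hε => ?_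
  obtain ⟨lo, hlo, hloq⟩ := exists_between (max_lt hmq (by linarith : q - ε < q))
  obtain ⟨hlom, hloε⟩ := max_lt_iff.1 hlo
  have hlo1 : 1 < lo := by linarith
  have hloval : ∀ᶠ n in Filter.atTop, 1 < digitVal lo (C n) :=
    (hlim lo hlo1).eventually (lt_mem_nhds
      (ha.val ▸ digitVal_lt_digitVal hlo1 hloq ha.le hm h0))
  obtain ⟨hi, hqhi, hhim, hhiε, hhival⟩ : ∃ hi, q ≤ hi ∧ hi ≤ m + 1 ∧ hi < q + ε ∧
      ∀ᶠ n in Filter.atTop, digitVal hi (C n) ≤ 1 := by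
    rcases hqm.lt_or_eq with hlt | heq
    · obtain ⟨hi, h1, h2⟩ := exists_between (lt_min hlt (by linarith : q < q + ε))
      obtain ⟨h3, h4⟩ := lt_min_iff.1 h2
      refine ⟨hi, h1.le, h3.le, h4, ?_⟩
      exact ((hlim hi (hq.trans h1)).eventually (gt_mem_nhds
        (ha.val ▸ digitVal_lt_digitVal hq h1 ha.le hm h0))).mono fun n hn => hn.le
    · refine ⟨q, le_rfl, hqm, by linarith, Filter.Eventually.of_forall fun n => ?_⟩
      have := digitVal_le hq (hCle n)
      rwa [heq, add_sub_cancel_right, div_self (by positivity), ← heq] at this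
  obtain ⟨n, hn1, hn2⟩ := (hloval.and hhival).exists
  obtain ⟨p, ⟨hp1, hp2⟩, hp⟩ := intermediate_value_Icc' (hloq.le.trans hqhi)
    (fun p hp => (continuousAt_digitVal (by linarith [hp.1]) (hCle n)).continuousWithinAt)
    ⟨hn2, hn1.le⟩
  refine ⟨p, mem_USet_of_isReflectDominated (by linarith) (by linarith) (by linarith) hm
    (hCle n) hp (hCs n) (hCK n), ?_⟩
  rw [Real.dist_eq, abs_lt]
  exact ⟨by linarith, by linarith⟩

end Closure

/-! ### Subshifts -/

section Subshifts

variable {q : ℝ} {m : ℕ} {a : ℕ → ℕ} {S : Set (ℕ → ℕ)}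

/-- A set defined by a condition on all windows of a fixed length is a subshift of finite type. -/
lemma isSubshiftOfFiniteType_of_window {L : ℕ} (hL : 0 < L) (P : (ℕ → ℕ) → Prop)
    (hP : ∀ c d : ℕ → ℕ, (∀ i < L, c i = d i) → P c → P d)
    (hS : ∀ c : ℕ → ℕ, (∀ i, c i ≤ m) → (c ∈ S ↔ ∀ n, P (shiftSeq n c))) :
    IsSubshiftOfFiniteType m S := by
  refine ⟨{l | ∃ c : ℕ → ℕ, (∀ i, c i ≤ m) ∧ ¬ P c ∧ l = List.ofFn fun j : Fin L => c j}, ?_,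
    fun c hc => ?_⟩
  · refine (Set.finite_range fun v : Fin L → Fin (m + 1) =>
      List.ofFn fun j => (v j : ℕ)).subset ?_
    rintro l ⟨c, hc, -, rfl⟩
    exact ⟨fun j => ⟨c j, Nat.lt_succ_of_le (hc j)⟩, rfl⟩
  · rw [hS c hc]
    constructor
    · rintro h i n - ⟨d, -, hd, hl⟩
      have hn : n = L := by simpa using congrArg List.length hl
      subst hn
      have h1 := List.ofFn_injective hl
      exact hd (hP _ _ (fun j hj => congrFun h1 ⟨j, hj⟩) (h i))
    · intro h n
      by_contra hn
      exact h n L hL ⟨shiftSeq n c, fun i => hc _, hn, rfl⟩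

lemma isSubshiftOfFiniteType_of_not_isReflectDominated (hm : 0 < m) (hq : 1 < q)
    (hmq : (m : ℝ) < q) (hqm : q ≤ m + 1) (ha : IsQuasiGreedyUnit q m a)
    (hK : ¬ IsReflectDominated m a) (hS : ∀ c, c ∈ S ↔ IsUnivoque q m c) :
    IsSubshiftOfFiniteType m S := by
  have h0 := ha.head_eq hq hmq
  obtain ⟨j, hj, hKj⟩ : ∃ j, 0 < a j ∧ ¬ LexLt (reflectSeq m (shiftSeq (j + 1) a)) a := by
    by_contra! hall
    refine hK fun k => ?_
    induction k with
    | zero => exact reflectSeq_shiftSeq_zero_lexLt hm h0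
    | succ j ih =>
      rcases Nat.eq_zero_or_pos (a j) with hj | hj
      · exact reflectSeq_shiftSeq_succ_lexLt (ha.isShiftMaximal hq) h0 hj ih
      · exact hall j hj
  let Q : (ℕ → ℕ) → Prop := fun d => ∃ i < j + 1, (∀ l < i, d (l + 1) = a l) ∧ d (i + 1) < a i
  have hQ : ∀ c d : ℕ → ℕ, (∀ i < j + 2, c i = d i) → Q c → Q d := by
    rintro c d hcd ⟨i, hi, h1, h2⟩
    exact ⟨i, hi, fun l hl => by rw [← hcd _ (by omega), h1 l hl],
      by rwa [← hcd _ (by omega)]⟩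
  have hQlex : ∀ (n : ℕ) (c : ℕ → ℕ), Q (shiftSeq n c) → LexLt (shiftSeq (n + 1) c) a := by
    rintro n c ⟨i, -, h1, h2⟩
    refine ⟨i, fun l hl => ?_, ?_⟩
    · rw [← h1 l hl]
      simp only [shiftSeq]
      congr 1
      omega
    · simp only [shiftSeq] at h2 ⊢
      convert h2 using 2
      omega
  have hlexQ : ∀ (n : ℕ) (c : ℕ → ℕ), IsUnivoque q m c → c n < m → Q (shiftSeq n c) := by
    intro n c hc hn
    obtain ⟨i, h1, h2⟩ := hc.shiftSeq_lexLt hq hqm ha hn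
    simp only [shiftSeq] at h1 h2
    by_cases hi : i < j + 1
    · refine ⟨i, hi, fun l hl => ?_, ?_⟩
      · rw [← h1 l hl]
        simp only [shiftSeq]
        congr 1
        omega
      · simp only [shiftSeq]
        convert h2 using 2
        omega
    · exfalso
      have h3 : 0 < c (n + 1 + j) := by rw [h1 j (by omega)]; exact hj
      have h4 := hc.reflectSeq_shiftSeq_lexLt hq hqm ha h3
      have h5 : LexLt (shiftSeq (n + 1 + j + 1) c) (shiftSeq (j + 1) a) := by
        refine ⟨i - (j + 1), fun l hl => ?_, ?_⟩
        · simp only [shiftSeq]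
          rw [← h1 _ (by omega)]
          congr 1
          omega
        · simp only [shiftSeq]
          convert h2 using 2 <;> omega
      exact hKj ((h5.reflectSeq fun i => ha.le _).trans h4)
  refine isSubshiftOfFiniteType_of_window (L := j + 2) (by omega)
    (fun d => (d 0 < m → Q d) ∧ (0 < d 0 → Q (reflectSeq m d))) ?_ fun c hc => ?_
  · rintro c d hcd ⟨h1, h2⟩
    rw [hcd 0 (by omega)] at h1 h2
    exact ⟨fun h => hQ c d hcd (h1 h), fun h => hQ _ _
      (fun i hi => by simp only [reflectSeq, hcd i hi]) (h2 h)⟩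
  · rw [hS]
    constructor
    · refine fun h n => ⟨fun hn => hlexQ n c h hn, fun hn => hlexQ n (reflectSeq m c)
        (h.reflectSeq hq) ?_⟩
      have := hc n
      simp only [shiftSeq, add_zero] at hn
      simp only [reflectSeq]
      omega
    · exact fun h => isUnivoque_of_lexLt hq ha hc (fun n hn => hQlex n c ((h n).1 hn))
        fun n hn => hQlex n (reflectSeq m c) ((h n).2 hn)

lemma isClosed_of_isSubshift (h : IsSubshift m S) :
    IsClosed {c : ℕ → Fin (m + 1) | (fun i => (c i : ℕ)) ∈ S} := by
  obtain ⟨F, hF⟩ := h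
  have hset : {c : ℕ → Fin (m + 1) | (fun i => (c i : ℕ)) ∈ S} = ⋂ (i : ℕ) (n : ℕ) (_ : 0 < n),
      (fun (c : ℕ → Fin (m + 1)) (j : Fin n) => c (i + j)) ⁻¹'
        {v | (List.ofFn fun j => (v j : ℕ)) ∉ F} := by
    ext c
    simp only [Set.mem_iInter, Set.mem_preimage, Set.mem_ofPred_eq]
    exact hF _ fun i => Nat.lt_succ_iff.1 (c i).2
  rw [hset]
  refine isClosed_iInter fun i => isClosed_iInter fun n => isClosed_iInter fun _ => ?_
  exact (isClosed_discrete _).preimage (continuous_pi fun j => continuous_apply _)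

lemma not_isClosed_of_isReflectDominated (hm : 0 < m) (hq : 1 < q)
    (hmq : (m : ℝ) < q) (hqm : q ≤ m + 1) (ha : IsQuasiGreedyUnit q m a)
    (hK : IsReflectDominated m a) (hS : ∀ c, c ∈ S ↔ IsUnivoque q m c) :
    ¬ IsClosed {c : ℕ → Fin (m + 1) | (fun i => (c i : ℕ)) ∈ S} := by
  intro hcl
  have h0 := ha.head_eq hq hmq
  have hs := ha.isShiftMaximal hq
  let z : (ℕ → ℕ) → ℕ → ℕ := fun b i => if i = 0 then 0 else b (i - 1)
  have hzs : ∀ b n, shiftSeq (n + 1) (z b) = shiftSeq n b := fun b n => by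
    funext i
    simp only [shiftSeq, z]
    rw [if_neg (by omega)]
    congr 1
    omega
  have hzle : ∀ b : ℕ → ℕ, (∀ i, b i ≤ m) → ∀ i, z b i < m + 1 := fun b hb i => by
    have := hb (i - 1)
    simp only [z]
    split_ifs <;> omega
  choose N hN hg using fun n => exists_isReflectDominatedPrefix_ge hs hK (n + 2)
  have hble : ∀ n i, lowerPeriodic (N n) a i ≤ m := fun n => lowerPeriodic_le ha.le
  have hmem : (fun i => (⟨z a i, hzle a ha.le i⟩ : Fin (m + 1))) ∈
      {c : ℕ → Fin (m + 1) | (fun i => (c i : ℕ)) ∈ S} := by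
    refine hcl.mem_of_tendsto (f := fun n i =>
      (⟨z (lowerPeriodic (N n) a) i, hzle _ (hble n) i⟩ : Fin (m + 1))) (b := Filter.atTop)
      (tendsto_pi_nhds.2 fun i => tendsto_const_nhds.congr' ?_)
      (Filter.Eventually.of_forall fun n => ?_)
    · filter_upwards [Filter.eventually_ge_atTop i] with n hn
      have := hN n
      simp only [z, Fin.mk.injEq]
      split_ifs
      · rfl
      · rw [lowerPeriodic_of_lt (by omega)]
    · have hN2 : 2 ≤ N n := le_trans (by omega) (hN n)
      refine (hS _).2 (isUnivoque_of_lexLt hq ha (fun i => Nat.lt_succ_iff.1 (hzle _ (hble n) i))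
        (fun k _ => ?_) fun k _ => ?_)
      · change LexLt (shiftSeq (k + 1) (z (lowerPeriodic (N n) a))) a
        rw [hzs]
        exact shiftSeq_lowerPeriodic_lexLt hs h0 hN2 (hg n) k
      · change LexLt (reflectSeq m (shiftSeq (k + 1) (z (lowerPeriodic (N n) a)))) a
        rw [hzs]
        exact reflectSeq_shiftSeq_lowerPeriodic_lexLt hm ha.le h0 hN2 (hg n) k
  have huni : IsUnivoque q m (z a) := (hS _).1 hmem
  have hlt := huni.shiftSeq_lexLt hq hqm ha (n := 0) hm
  rw [hzs, shiftSeq_zero] at hlt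
  exact lexLt_irrefl _ hlt

end Subshifts

/-- Equivalence of: `q ∉ closure U`; `U_q'` is a subshift of finite
type; `U_q'` is a subshift; `U_q'` is closed in `{0, …, α₁}^ℕ`. -/
theorem UqSeq_subshift_tfae (q : ℝ) (hq : 1 < q) :
    (q ∉ closure USet ↔ IsSubshiftOfFiniteType (alphaOne q) (UqSeq q)) ∧
    (IsSubshiftOfFiniteType (alphaOne q) (UqSeq q) ↔ IsSubshift (alphaOne q) (UqSeq q)) ∧
    (IsSubshift (alphaOne q) (UqSeq q) ↔
      IsClosed {c : ℕ → Fin (alphaOne q + 1) | (fun i => (c i : ℕ)) ∈ UqSeq q}) := by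
  have hqm := (alphaOne_eq_iff hq).1 rfl
  have hS : ∀ c, c ∈ UqSeq q ↔ IsUnivoque q (alphaOne q) c := fun c => mem_UqSeq_iff
  generalize alphaOne q = m at hqm hS ⊢
  obtain ⟨hmq, hqm⟩ := hqm
  have hm : 0 < m := by
    rcases Nat.eq_zero_or_pos m with rfl | h
    · norm_num at hqm
      linarith
    · exact h
  have h12 : q ∉ closure USet → IsSubshiftOfFiniteType m (UqSeq q) := fun h => by
    obtain ⟨a, ha⟩ := exists_isQuasiGreedyUnit hq hqm
    exact isSubshiftOfFiniteType_of_not_isReflectDominated hm hq hmq hqm ha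
      (fun hK => h (mem_closure_USet hm hq hmq hqm ha hK)) hS
  have h23 : IsSubshiftOfFiniteType m (UqSeq q) → IsSubshift m (UqSeq q) :=
    fun ⟨F, _, hF⟩ => ⟨F, hF⟩
  have h34 := isClosed_of_isSubshift (m := m) (S := UqSeq q)
  have h41 : IsClosed {c : ℕ → Fin (m + 1) | (fun i => (c i : ℕ)) ∈ UqSeq q} →
      q ∉ closure USet := fun hcl hq' => by
    obtain ⟨a, ha, hK⟩ : ∃ a, IsQuasiGreedyUnit q m a ∧ IsReflectDominated m a := by
      rcases hqm.lt_or_eq with hlt | rfl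
      · exact exists_isReflectDominated_of_mem_closure hm hq hmq hlt hq'
      · exact ⟨_, isQuasiGreedyUnit_const hm, isReflectDominated_const hm⟩
    exact not_isClosed_of_isReflectDominated hm hq hmq hqm ha hK hS hcl
  exact ⟨⟨h12, fun h => h41 (h34 (h23 h))⟩, ⟨h23, fun h => h12 (h41 (h34 h))⟩,
    h34, fun h => h23 (h12 (h41 h))⟩
end
end
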